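/- arXiv:math/0305057 — 4 statements merged into one kernel-verified Lean document; each statement's English description precedes it below -/
import Mathlib

section
/- Let K be a field of characteristic zero and n ≥ 16. For x = (x_1,…,x_5) and y = (y_1,…,y_5) in K^5, the Lie algebras g_x and g_y are isomorphic if and only if there exists α ∈ K with α ≠ 0 such that y_1 = α^{n−11}·x_1, y_2 = α^{n−10}·x_2, y_3 = α^{n−9}·x_3, y_4 = α^{n−8}·x_4 and y_5 = α^{n−7}·x_5. -/
namespace Paper

open Module Submodule

section Polynomials

variable {K : Type*} [Field K]

/-- The binomial coefficient `C(t, 2) = t(t-1)/2` as a polynomial expression. -/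
def ch2 (t : K) : K := t * (t - 1) / 2
/-- The binomial coefficient `C(t, 3) = t(t-1)(t-2)/6` as a polynomial expression. -/
def ch3 (t : K) : K := t * (t - 1) * (t - 2) / 6
/-- The binomial coefficient `C(t, 4) = t(t-1)(t-2)(t-3)/24` as a polynomial expression. -/
def ch4 (t : K) : K := t * (t - 1) * (t - 2) * (t - 3) / 24

def P1 (t : K) : K := (5 * ch2 t + 3 * t - 6) / 21
def P2 (t : K) : K := -(4 * ch2 t + 15 * t - 30) / 21
def P3 (t : K) : K := -(13 * ch2 t - 30 * t + 60) / 21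
def Q1 (t : K) : K := (3 * ch3 (t + 1) + 4 * ch2 (t + 1) - 4 * (t + 1)) / 28
def Q2 (t : K) : K := (ch3 (t + 1) - 8 * ch2 (t + 1) + 8 * (t + 1)) / 14
def Q3 (t : K) : K := (-13 * ch3 (t + 1) + 20 * ch2 (t + 1) - 20 * (t + 1)) / 28
def Z1 (t : K) : K :=
  (1 / 22) * ch4 (t + 2) + (23 / 231) * ch3 (t + 2) - (7 / 198) * ch2 (t + 2)
    - (59 / 693) * (t + 2) + 37 / 231
def Z2 (t : K) : K :=
  (17 / 154) * ch4 (t + 2) - (62 / 231) * ch3 (t + 2) - (53 / 1386) * ch2 (t + 2)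
    - (59 / 99) * (t + 2) - 37 / 33
def Z3 (t : K) : K :=
  -(29 / 154) * ch4 (t + 2) - (4 / 77) * ch3 (t + 2) + (317 / 462) * ch2 (t + 2)
    - (59 / 33) * (t + 2) + 37 / 11
def Z4 (t : K) : K :=
  -(47 / 154) * ch4 (t + 2) + (185 / 231) * ch3 (t + 2) - (2245 / 1386) * ch2 (t + 2)
    + (295 / 99) * (t + 2) - 185 / 33

end Polynomials

section Psi

variable (K : Type*) [Field K] {g : Type*} [AddCommGroup g] [Module K g]

/-- The value of the cocycle `ψ_{n,7}` on the basis pair `(e_i, e_j)`, `i < j`. -/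
def psi7 (n : ℕ) (E : ℕ → g) (i j : ℕ) : g :=
  if i = 2 ∧ j = 5 then E n
  else if i = 3 ∧ j = 4 then (-3 : K) • E n
  else 0

/-- The value of the cocycle `ψ_{n,8}` on the basis pair `(e_i, e_j)`, `i < j`. -/
def psi8 (n : ℕ) (E : ℕ → g) (i j : ℕ) : g :=
  if i = 2 ∧ j = 5 then E (n - 1)
  else if i = 3 ∧ j = 4 then (-3 : K) • E (n - 1)
  else if i = 2 ∧ j = 6 then (((n : K) - 2) / 2) • E n
  else if i = 3 ∧ j = 5 then (-((n : K) - 2)) • E n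
  else 0

/-- The value of the cocycle `ψ_{n,9}` on the basis pair `(e_i, e_j)`, `i < j`. -/
def psi9 (n : ℕ) (E : ℕ → g) (i j : ℕ) : g :=
  if i = 2 ∧ j = 5 then E (n - 2)
  else if i = 3 ∧ j = 4 then (-3 : K) • E (n - 2)
  else if i = 2 ∧ j = 6 then (((n : K) - 3) / 2) • E (n - 1)
  else if i = 3 ∧ j = 5 then (-((n : K) - 3)) • E (n - 1)
  else if i = 2 ∧ j = 7 then P1 ((n : K) - 2) • E n
  else if i = 3 ∧ j = 6 then P2 ((n : K) - 2) • E n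
  else if i = 4 ∧ j = 5 then P3 ((n : K) - 2) • E n
  else 0

/-- The value of the cocycle `ψ_{n,10}` on the basis pair `(e_i, e_j)`, `i < j`. -/
def psi10 (n : ℕ) (E : ℕ → g) (i j : ℕ) : g :=
  if i = 2 ∧ j = 5 then E (n - 3)
  else if i = 3 ∧ j = 4 then (-3 : K) • E (n - 3)
  else if i = 2 ∧ j = 6 then (((n : K) - 4) / 2) • E (n - 2)
  else if i = 3 ∧ j = 5 then (-((n : K) - 4)) • E (n - 2)
  else if i = 2 ∧ j = 7 then P1 ((n : K) - 3) • E (n - 1)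
  else if i = 3 ∧ j = 6 then P2 ((n : K) - 3) • E (n - 1)
  else if i = 4 ∧ j = 5 then P3 ((n : K) - 3) • E (n - 1)
  else if i = 2 ∧ j = 8 then Q1 ((n : K) - 3) • E n
  else if i = 3 ∧ j = 7 then Q2 ((n : K) - 3) • E n
  else if i = 4 ∧ j = 6 then Q3 ((n : K) - 3) • E n
  else 0

/-- The value of the cocycle `ψ_{n,11}` on the basis pair `(e_i, e_j)`, `i < j`. -/
def psi11 (n : ℕ) (E : ℕ → g) (i j : ℕ) : g :=
  if i = 2 ∧ j = 5 then E (n - 4)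
  else if i = 3 ∧ j = 4 then (-3 : K) • E (n - 4)
  else if i = 2 ∧ j = 6 then (((n : K) - 5) / 2) • E (n - 3)
  else if i = 3 ∧ j = 5 then (-((n : K) - 5)) • E (n - 3)
  else if i = 2 ∧ j = 7 then P1 ((n : K) - 4) • E (n - 2)
  else if i = 3 ∧ j = 6 then P2 ((n : K) - 4) • E (n - 2)
  else if i = 4 ∧ j = 5 then P3 ((n : K) - 4) • E (n - 2)
  else if i = 2 ∧ j = 8 then Q1 ((n : K) - 4) • E (n - 1)
  else if i = 3 ∧ j = 7 then Q2 ((n : K) - 4) • E (n - 1)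
  else if i = 4 ∧ j = 6 then Q3 ((n : K) - 4) • E (n - 1)
  else if i = 2 ∧ j = 9 then Z1 ((n : K) - 4) • E n
  else if i = 3 ∧ j = 8 then Z2 ((n : K) - 4) • E n
  else if i = 4 ∧ j = 7 then Z3 ((n : K) - 4) • E n
  else if i = 5 ∧ j = 6 then Z4 ((n : K) - 4) • E n
  else 0

/-- The value of `x_1 ψ_{n,11} + x_2 ψ_{n,10} + x_3 ψ_{n,9} + x_4 ψ_{n,8} + x_5 ψ_{n,7}`
on the basis pair `(e_i, e_j)`, `i < j`; here `x = (x_1, …, x_5) ∈ K^5`. -/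
def defTerm (n : ℕ) (E : ℕ → g) (x : Fin 5 → K) (i j : ℕ) : g :=
  x 0 • psi11 K n E i j + x 1 • psi10 K n E i j + x 2 • psi9 K n E i j +
    x 3 • psi8 K n E i j + x 4 • psi7 K n E i j

end Psi

variable (K : Type*) [Field K] {g : Type*} [LieRing g] [LieAlgebra K g]

/-- `E : ℕ → g` enumerates a basis `e_1, …, e_n` of the Lie algebra `V_n`
(with `E m = 0` for `m = 0` or `m > n`), i.e. `⁅e_i, e_j⁆ = (j - i) • e_{i+j}`
for `i + j ≤ n` and `⁅e_i, e_j⁆ = 0` for `i + j > n` (`1 ≤ i < j ≤ n`). -/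
def IsVnBasis (n : ℕ) (E : ℕ → g) : Prop :=
  (∃ b : Basis (Fin n) K g, ∀ i : Fin n, E ((i : ℕ) + 1) = b i) ∧
  (∀ m : ℕ, m = 0 ∨ n < m → E m = 0) ∧
  (∀ i j : ℕ, 1 ≤ i → i < j → j ≤ n →
    ⁅E i, E j⁆ = ((j : K) - (i : K)) • E (i + j))

/-- `B` is the deformed bracket `[·,·]_x` of `g_x` on `V_n` (with basis `E`): it is the
alternating bilinear map with
`B(e_i, e_j) = (j - i) • e_{i+j} + (x_1 ψ_{n,11} + ⋯ + x_5 ψ_{n,7})(e_i, e_j)`. -/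
def IsDeformedBracket (n : ℕ) (E : ℕ → g) (x : Fin 5 → K)
    (B : g →ₗ[K] g →ₗ[K] g) : Prop :=
  (∀ u : g, B u u = 0) ∧
  (∀ i j : ℕ, 1 ≤ i → i < j → j ≤ n →
    B (E i) (E j) = ((j : K) - (i : K)) • E (i + j) + defTerm K n E x i j)

section Helpers

variable {L M : Type*} [Field L] [AddCommGroup M] [Module L M]

structure Frame (n : ℕ) (E : ℕ → M) (cf : ℕ → M →ₗ[L] L) : Prop where
  cfE : ∀ i j, cf i (E j) = if i = j ∧ 1 ≤ i ∧ i ≤ n then 1 else 0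
  dec : ∀ v, v = ∑ k ∈ Finset.range (n + 1), cf k v • E k

def Fil (cf : ℕ → M →ₗ[L] L) (m : ℕ) : Submodule L M where
  carrier := {v | ∀ i < m, cf i v = 0}
  add_mem' := by
    intro a b ha hb i hi
    simp [ha i hi, hb i hi]
  zero_mem' := by
    intro i _
    simp
  smul_mem' := by
    intro c a ha i hi
    simp [ha i hi]

structure Good (n : ℕ) (E : ℕ → M) (cf : ℕ → M →ₗ[L] L) (B : M →ₗ[L] M →ₗ[L] M) : Prop where
  alt : ∀ u, B u u = 0
  lead : ∀ i j : ℕ, 1 ≤ i → 1 ≤ j →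
    B (E i) (E j) - ((j : L) - (i : L)) • E (i + j) ∈ Fil cf (i + j + 1)
  one : ∀ j : ℕ, 1 ≤ j → B (E 1) (E j) = ((j : L) - 1) • E (j + 1)
  two3 : B (E 2) (E 3) = E 5

variable {n : ℕ} {E : ℕ → M} {cf : ℕ → M →ₗ[L] L}

lemma mem_Fil {m : ℕ} {v : M} : v ∈ Fil cf m ↔ ∀ i < m, cf i v = 0 := Iff.rfl

lemma Fil_anti {a b : ℕ} (h : a ≤ b) {v : M} (hv : v ∈ Fil cf b) : v ∈ Fil cf a :=
  fun i hi => hv i (lt_of_lt_of_le hi h)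

lemma Frame.E_mem (hF : Frame n E cf) {m j : ℕ} (h : m ≤ j) : E j ∈ Fil cf m := by
  intro i hi
  rw [hF.cfE, if_neg]
  omega

lemma Frame.E_zero (hF : Frame n E cf) {m : ℕ} (h : m = 0 ∨ n < m) : E m = 0 := by
  rw [hF.dec (E m)]
  refine Finset.sum_eq_zero fun k hk => ?_
  rw [hF.cfE, if_neg, zero_smul]
  omega

lemma Frame.cf_zero (hF : Frame n E cf) {m : ℕ} (h : m = 0 ∨ n < m) (v : M) : cf m v = 0 := by
  rw [hF.dec v, map_sum]
  refine Finset.sum_eq_zero fun k hk => ?_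
  rw [map_smul, hF.cfE, if_neg, smul_zero]
  omega

lemma Frame.Fil_top (hF : Frame n E cf) {m : ℕ} (hm : n < m) {v : M} (hv : v ∈ Fil cf m) :
    v = 0 := by
  rw [hF.dec v]
  refine Finset.sum_eq_zero fun k hk => ?_
  rw [hv k, zero_smul]
  simp at hk
  omega

lemma Frame.Fil_dec (hF : Frame n E cf) {m : ℕ} {v : M} (hv : v ∈ Fil cf m) :
    v - cf m v • E m ∈ Fil cf (m + 1) := by
  intro i hi
  by_cases h : m = 0 ∨ n < m
  · rw [hF.cf_zero h, zero_smul, sub_zero]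
    rcases Nat.lt_succ_iff_lt_or_eq.mp hi with h1 | h1
    · exact hv i h1
    · rw [h1]; exact hF.cf_zero h v
  · rw [map_sub, map_smul, hF.cfE]
    rcases Nat.lt_succ_iff_lt_or_eq.mp hi with h1 | h1
    · rw [if_neg (by omega), hv i h1]; simp
    · subst h1
      rw [if_pos (by omega)]; simp

lemma Frame.coef_zero (hF : Frame n E cf) {m : ℕ} (h1 : 1 ≤ m) (h2 : m ≤ n) {c : L}
    (h : c • E m ∈ Fil cf (m + 1)) : c = 0 := by
  have := h m (by omega)
  rwa [map_smul, hF.cfE, if_pos (by omega), smul_eq_mul, mul_one] at this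

lemma skew_of_alt {B : M →ₗ[L] M →ₗ[L] M} (h : ∀ u, B u u = 0) (u v : M) :
    B u v = - B v u := by
  have := h (u + v)
  simp only [map_add, LinearMap.add_apply, h, zero_add, add_zero] at this
  rw [eq_neg_iff_add_eq_zero, add_comm]
  exact this

lemma bil_fil (hF : Frame n E cf) {B : M →ₗ[L] M →ₗ[L] M} {s : ℕ}
    (hB : ∀ i j : ℕ, 1 ≤ i → 1 ≤ j → B (E i) (E j) ∈ Fil cf (i + j + s)) {i j : ℕ}
    {u v : M} (hi : 1 ≤ i) (hj : 1 ≤ j)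
    (hu : u ∈ Fil cf i) (hv : v ∈ Fil cf j) : B u v ∈ Fil cf (i + j + s) := by
  rw [hF.dec u, hF.dec v]
  simp only [map_sum, map_smul, LinearMap.sum_apply, LinearMap.smul_apply]
  refine Submodule.sum_mem _ fun a _ => ?_
  by_cases ha : a < j
  · rw [hv a ha, zero_smul]; exact Submodule.zero_mem _
  refine Submodule.smul_mem _ _ (Submodule.sum_mem _ fun b _ => ?_)
  by_cases hb : b < i
  · rw [hu b hb, zero_smul]; exact Submodule.zero_mem _
  refine Submodule.smul_mem _ _ (Fil_anti ?_ (hB b a (by omega) (by omega)))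
  omega

lemma Good.fil {B : M →ₗ[L] M →ₗ[L] M} (hB : Good n E cf B) (hF : Frame n E cf) {i j : ℕ}
    {u v : M} (hi : 1 ≤ i) (hj : 1 ≤ j)
    (hu : u ∈ Fil cf i) (hv : v ∈ Fil cf j) : B u v ∈ Fil cf (i + j) := by
  refine bil_fil hF (s := 0) ?_ hi hj hu hv
  intro i j hi hj
  have h1 := Fil_anti (Nat.le_succ _) (hB.lead i j hi hj)
  have h2 := Submodule.smul_mem _ ((j : L) - (i : L)) (hF.E_mem (le_refl (i + j)))
  simpa using Submodule.add_mem _ h1 h2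

/-- first-order expansion -/
lemma Good.expand {B : M →ₗ[L] M →ₗ[L] M} (hB : Good n E cf B) (hF : Frame n E cf) {i j k : ℕ}
    {u v : M} (hi : 1 ≤ i) (hj : 1 ≤ j) (hk : 1 ≤ k)
    (hu : u - E i ∈ Fil cf (i + k)) (hv : v - E j ∈ Fil cf (j + k)) :
    B u v - B (E i) (E j) - (cf (i + k) u * ((j : L) - i - k) + cf (j + k) v * ((j : L) + k - i)) •
      E (i + j + k) ∈ Fil cf (i + j + k + 1) := by
  have cu : cf (i + k) (u - E i) = cf (i + k) u := by
    rw [map_sub, hF.cfE, if_neg (by omega), sub_zero]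
  have cv : cf (j + k) (v - E j) = cf (j + k) v := by
    rw [map_sub, hF.cfE, if_neg (by omega), sub_zero]
  have ru := hF.Fil_dec hu
  have rv := hF.Fil_dec hv
  rw [cu] at ru
  rw [cv] at rv
  set a := cf (i + k) u
  set b := cf (j + k) v
  have t1 : B (u - E i - a • E (i + k)) v ∈ Fil cf (i + j + k + 1) := by
    have hv' : v ∈ Fil cf j := by
      have := Submodule.add_mem _ (Fil_anti (by omega) hv) (hF.E_mem (le_refl j))
      simpa using this
    have := hB.fil hF (by omega) hj ru hv'
    exact Fil_anti (by omega) this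
  have t2 : B (E i) (v - E j - b • E (j + k)) ∈ Fil cf (i + j + k + 1) := by
    have := hB.fil hF hi (by omega) (hF.E_mem (le_refl i)) rv
    exact Fil_anti (by omega) this
  have t3 : B (a • E (i + k)) (v - E j) ∈ Fil cf (i + j + k + 1) := by
    have := hB.fil hF (by omega) (by omega)
      (Submodule.smul_mem _ a (hF.E_mem (le_refl (i + k)))) hv
    exact Fil_anti (by omega) this
  have t4 := Submodule.smul_mem _ a (hB.lead (i + k) j (by omega) hj)
  have t5 := Submodule.smul_mem _ b (hB.lead i (j + k) hi (by omega))
  rw [show i + k + j = i + j + k by omega] at t4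
  rw [show i + (j + k) = i + j + k by omega] at t5
  have := Submodule.add_mem _ (Submodule.add_mem _ (Submodule.add_mem _ (Submodule.add_mem _ t1 t2) t3) t4) t5
  convert this using 1
  simp only [map_sub, map_smul, LinearMap.sub_apply, LinearMap.smul_apply]
  push_cast
  module

lemma Frame.mem_one (hF : Frame n E cf) (v : M) : v ∈ Fil cf 1 := by
  intro i hi
  exact hF.cf_zero (by omega) v

lemma pow_fil {D : M →ₗ[L] M} {k : ℕ}
    (hD : ∀ (j : ℕ) (v : M), 1 ≤ j → v ∈ Fil cf j → D v ∈ Fil cf (j + k)) (i : ℕ) :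
    ∀ (j : ℕ) (v : M), 1 ≤ j → v ∈ Fil cf j → (D ^ i) v ∈ Fil cf (j + i * k) := by
  induction i with
  | zero => intro j v _ hv; simpa using hv
  | succ i ih =>
    intro j v hj hv
    rw [pow_succ, Module.End.mul_apply]
    have := ih (j + k) (D v) (by omega) (hD j v hj hv)
    rwa [show j + (i + 1) * k = j + k + i * k by ring]

lemma exists_exp [CharZero L] {B : M →ₗ[L] M →ₗ[L] M} (hB : Good n E cf B) (hF : Frame n E cf)
    (hJ : ∀ a b c, B a (B b c) = B b (B a c) + B (B a b) c) {k : ℕ} (hk : 1 ≤ k) {u : M}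
    (hu : u ∈ Fil cf k) :
    ∃ θ : M →ₗ[L] M, (∀ a b, θ (B a b) = B (θ a) (θ b)) ∧
      ∀ (j : ℕ) (v : M), 1 ≤ j → v ∈ Fil cf j → θ v - v - B u v ∈ Fil cf (j + k + 1) := by
  let _ : Module ℚ M := Module.compHom M (algebraMap ℚ L)
  have hq : ∀ (q : ℚ) (v : M), q • v = (algebraMap ℚ L q) • v := fun q v => rfl
  have hD : ∀ (j : ℕ) (v : M), 1 ≤ j → v ∈ Fil cf j → (B u) v ∈ Fil cf (j + k) := by
    intro j v hj hv
    rw [add_comm]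
    exact hB.fil hF hk hj hu hv
  have hpow := pow_fil hD
  have hnil : (B u) ^ (n + 2) = 0 := by
    ext v
    have h1 := hpow (n + 2) 1 v le_rfl (hF.mem_one v)
    refine hF.Fil_top ?_ h1
    nlinarith
  refine ⟨IsNilpotent.exp (B u), ?_, ?_⟩
  · let _ : NonUnitalNonAssocRing M :=
      { (inferInstance : AddCommGroup M) with
        mul := fun a b => B a b
        left_distrib := fun a b c => map_add (B a) b c
        right_distrib := fun a b c => by
          change B (a + b) c = B a c + B b c
          simp
        zero_mul := fun a => by
          change B 0 a = 0
          simp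
        mul_zero := fun a => by
          change B a 0 = 0
          simp }
    have : SMulCommClass L M M := ⟨fun r a b => by
      change r • (B a b) = B a (r • b)
      simp⟩
    have : IsScalarTower L M M := ⟨fun r a b => by
      change B (r • a) b = r • (B a b)
      simp⟩
    intro a b
    exact Module.End.exp_mul_of_derivation L M (B u) (fun a b => hJ u a b) ⟨_, hnil⟩ a b
  · intro j v hj hv
    rw [IsNilpotent.exp_eq_sum hnil, Finset.sum_range_succ', Finset.sum_range_succ']
    simp only [LinearMap.add_apply, LinearMap.sum_apply, LinearMap.smul_apply]
    have : ∀ a b c d: M, a = b → c = d → ∀ s : M, s + a + c - d - b = s := by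
      intro a b c d h1 h2 s
      subst h1 h2
      abel
    rw [this]
    · refine Submodule.sum_mem _ fun i _ => ?_
      rw [hq]
      refine Submodule.smul_mem _ _ (Fil_anti ?_ (hpow (i + 1 + 1) j v hj hv))
      nlinarith
    · simp
    · simp

/-- almost homomorphism -/
structure AH (n : ℕ) (E : ℕ → M) (cf : ℕ → M →ₗ[L] L) (B B' : M →ₗ[L] M →ₗ[L] M)
    (φ : M →ₗ[L] M) : Prop where
  one : ∀ j : ℕ, 2 ≤ j → j ≠ 3 → φ (B (E 1) (E j)) = B' (φ (E 1)) (φ (E j))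
  one3 : φ (B (E 1) (E 3)) - B' (φ (E 1)) (φ (E 3)) ∈ Fil cf n
  two3 : φ (B (E 2) (E 3)) - B' (φ (E 2)) (φ (E 3)) ∈ Fil cf n
  two5 : φ (B (E 2) (E 5)) = B' (φ (E 2)) (φ (E 5))

def DD (E : ℕ → M) (cf : ℕ → M →ₗ[L] L) (k : ℕ) (φ : M →ₗ[L] M) : Prop :=
  ∀ j : ℕ, 1 ≤ j → φ (E j) - E j ∈ Fil cf (j + k)

lemma coef_eq {B B' : M →ₗ[L] M →ₗ[L] M} (hF : Frame n E cf) (hB' : Good n E cf B')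
    {φ : M →ₗ[L] M} {i j k : ℕ} (hi : 1 ≤ i) (hj : 1 ≤ j) (hk : 1 ≤ k) (hn : i + j + k < n)
    (hD : DD E cf k φ)
    (h : φ (B (E i) (E j)) - B' (φ (E i)) (φ (E j)) ∈ Fil cf n)
    (h1 : B (E i) (E j) = ((j : L) - i) • E (i + j))
    (h2 : B' (E i) (E j) = ((j : L) - i) • E (i + j)) :
    ((j : L) - i) * cf (i + j + k) (φ (E (i + j))) =
      cf (i + k) (φ (E i)) * ((j : L) - i - k) + cf (j + k) (φ (E j)) * ((j : L) + k - i) := by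
  have e := hB'.expand hF hi hj hk (hD i hi) (hD j hj)
  have := Submodule.add_mem _ (Fil_anti (show i + j + k + 1 ≤ n by omega) h) e
  have := this (i + j + k) (by omega)
  rw [h2, h1] at this
  have c1 : cf (i + j + k) (E (i + j)) = 0 := by
    rw [hF.cfE, if_neg (by omega)]
  have c2 : cf (i + j + k) (E (i + j + k)) = 1 := by
    rw [hF.cfE, if_pos (by omega)]
  simp only [map_sub, map_add, map_smul, c1, c2, smul_eq_mul] at this
  linear_combination this

lemma AH.propagate [CharZero L] {B B' : M →ₗ[L] M →ₗ[L] M} (hF : Frame n E cf)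
    (hB : Good n E cf B) (hB' : Good n E cf B') {φ : M →ₗ[L] M} {k : ℕ} (hk : 1 ≤ k)
    (hkn : k + 7 ≤ n) (hA : AH n E cf B B' φ) 
    (h1 : φ (E 1) - E 1 ∈ Fil cf (1 + (k + 1))) (h2 : φ (E 2) - E 2 ∈ Fil cf (2 + (k + 1))) :
    DD E cf (k + 1) φ := by
  have key : ∀ j, 2 ≤ j → φ (E j) - E j ∈ Fil cf (j + (k + 1)) := by
    intro j hj
    induction j, hj using Nat.le_induction with
    | base => exact h2
    | succ j hj ih =>
      have e : φ (B (E 1) (E j)) - B' (φ (E 1)) (φ (E j)) ∈ Fil cf (j + 1 + (k + 1)) := by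
        by_cases h3 : j = 3
        · subst h3
          exact Fil_anti (by omega) hA.one3
        · rw [hA.one j hj h3, sub_self]; exact Submodule.zero_mem _
      have f1 : B' (φ (E 1) - E 1) (φ (E j)) ∈ Fil cf (j + 1 + (k + 1)) := by
        have : φ (E j) ∈ Fil cf j := by
          have := Submodule.add_mem _ (Fil_anti (by omega) ih) (hF.E_mem (le_refl j))
          simpa using this
        exact Fil_anti (by omega) (hB'.fil hF (by omega) (by omega) h1 this)
      have f2 : B' (E 1) (φ (E j) - E j) ∈ Fil cf (j + 1 + (k + 1)) :=
        Fil_anti (by omega) (hB'.fil hF (by omega) (by omega) (hF.E_mem (le_refl 1)) ih)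
      have g := Submodule.add_mem _ e (Submodule.add_mem _ f1 f2)
      have hj0 : ((j : L) - 1) ≠ 0 := by
        rw [sub_ne_zero]
        exact_mod_cast (by omega : j ≠ 1)
      have g2 := Submodule.smul_mem _ ((j : L) - 1)⁻¹ g
      convert g2 using 1
      rw [eq_inv_smul_iff₀ hj0]
      have r1 := hB.one j (by omega)
      have r2 := hB'.one j (by omega)
      simp only [map_sub, LinearMap.sub_apply, r1, r2, map_smul]
      module
  intro j hj
  rcases Nat.lt_or_ge 1 j with h | h
  · exact key j h
  · obtain rfl : j = 1 := by omega
    exact h1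

lemma mem_next (hF : Frame n E cf) {φ : M →ₗ[L] M} {i k : ℕ} (hk : 1 ≤ k)
    (h : φ (E i) - E i ∈ Fil cf (i + k)) (h0 : cf (i + k) (φ (E i)) = 0) :
    φ (E i) - E i ∈ Fil cf (i + (k + 1)) := by
  have := hF.Fil_dec h
  rwa [map_sub, hF.cfE, if_neg (by omega), sub_zero, h0, zero_smul, sub_zero] at this

/-- vanishing of first order terms -/
lemma AH.eqs {B B' : M →ₗ[L] M →ₗ[L] M} (hF : Frame n E cf)
    (hB : Good n E cf B) (hB' : Good n E cf B') {φ : M →ₗ[L] M} {k : ℕ} (hk : 1 ≤ k)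
    (hA : AH n E cf B B' φ) (hD : DD E cf k φ) :
    (∀ j : ℕ, 2 ≤ j → 1 + j + k < n → ((j : L) - 1) * cf (1 + j + k) (φ (E (1 + j))) =
      cf (1 + k) (φ (E 1)) * ((j : L) - 1 - k) + cf (j + k) (φ (E j)) * ((j : L) + k - 1)) ∧
    (5 + k < n → cf (5 + k) (φ (E 5)) =
      cf (2 + k) (φ (E 2)) * (1 - (k : L)) + cf (3 + k) (φ (E 3)) * (1 + (k : L))) := by
  constructor
  · intro j hj hjn
    have := coef_eq (B := B) (B' := B') hF hB' (i := 1) (j := j) le_rfl (by omega) hk hjn hD ?_ ?_ ?_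
    · simpa using this
    · by_cases h3 : j = 3
      · subst h3
        exact hA.one3
      · rw [hA.one j hj h3, sub_self]; exact Submodule.zero_mem _
    · rw [hB.one j (by omega), add_comm]; simp
    · rw [hB'.one j (by omega), add_comm]; simp
  · intro h
    have := coef_eq (B := B) (B' := B') hF hB' (i := 2) (j := 3) (by omega) (by omega) hk h hD
      hA.two3 ?_ ?_
    · norm_num at this
      linear_combination this
    · rw [hB.two3]; norm_num
    · rw [hB'.two3]; norm_num

lemma AH.step [CharZero L] {B B' : M →ₗ[L] M →ₗ[L] M} (hF : Frame n E cf)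
    (hB : Good n E cf B) (hB' : Good n E cf B')
    (hJ : ∀ a b c, B' a (B' b c) = B' b (B' a c) + B' (B' a b) c)
    {φ : M →ₗ[L] M} {k : ℕ} (hk : 1 ≤ k)
    (hkn : k + 7 ≤ n) (hA : AH n E cf B B' φ) (hD : DD E cf k φ) :
    ∃ φ' : M →ₗ[L] M, AH n E cf B B' φ' ∧ DD E cf (k + 1) φ' := by
  -- choose the inner automorphism
  have main : ∀ c : L, ∃ φ' : M →ₗ[L] M, AH n E cf B B' φ' ∧ DD E cf k φ' ∧
      (∀ j : ℕ, 1 ≤ j → j + k ≤ n →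
        cf (j + k) (φ' (E j)) = cf (j + k) (φ (E j)) + c * ((j : L) - k)) := by
    intro c
    obtain ⟨θ, hθ, hθ2⟩ := exists_exp hB' hF hJ hk
      (Submodule.smul_mem _ c (hF.E_mem (le_refl k)))
    have hθF : ∀ (j : ℕ) (v : M), 1 ≤ j → v ∈ Fil cf j → θ v ∈ Fil cf j := by
      intro j v hj hv
      have a1 := Fil_anti (by omega : j ≤ _) (hθ2 j v hj hv)
      have a2 := Fil_anti (by omega : j ≤ _) (hB'.fil hF hk hj
        (Submodule.smul_mem _ c (hF.E_mem (le_refl k))) hv)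
      have := Submodule.add_mem _ (Submodule.add_mem _ a1 a2) hv
      convert this using 1
      abel
    have hex : ∀ j : ℕ, 1 ≤ j → θ (φ (E j)) - φ (E j) - (c * ((j : L) - k)) • E (j + k)
        ∈ Fil cf (j + k + 1) := by
      intro j hj
      have hφ : φ (E j) ∈ Fil cf j := by
        have := Submodule.add_mem _ (Fil_anti (by omega) (hD j hj)) (hF.E_mem (le_refl j))
        simpa using this
      have a1 := hθ2 j _ hj hφ
      have a2 := hB'.fil hF hk (by omega)
        (Submodule.smul_mem _ c (hF.E_mem (le_refl k))) (hD j hj)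
      have a3 := Submodule.smul_mem _ c (hB'.lead k j hk hj)
      rw [add_comm k j] at a3
      have := Submodule.add_mem _ (Submodule.add_mem _ a1 (Fil_anti (by omega) a2)) a3
      convert this using 1
      simp only [map_sub, map_smul, LinearMap.smul_apply]
      module
    refine ⟨θ ∘ₗ φ, ⟨?_, ?_, ?_, ?_⟩, ?_, ?_⟩
    · intro j hj h3
      simp only [LinearMap.comp_apply, hA.one j hj h3, hθ]
    · simp only [LinearMap.comp_apply, ← hθ, ← map_sub]
      exact hθF n _ (by omega) hA.one3
    · simp only [LinearMap.comp_apply, ← hθ, ← map_sub]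
      exact hθF n _ (by omega) hA.two3
    · simp only [LinearMap.comp_apply, hA.two5, hθ]
    · intro j hj
      have b1 := Fil_anti (by omega : j + k ≤ _) (hex j hj)
      have b2 := Submodule.smul_mem _ (c * ((j : L) - k)) (hF.E_mem (le_refl (j + k)))
      have := Submodule.add_mem _ (Submodule.add_mem _ b1 b2) (hD j hj)
      convert this using 1
      simp only [LinearMap.comp_apply]
      abel
    · intro j hj hjn
      have := hex j hj (j + k) (by omega)
      rw [map_sub, map_sub, map_smul, hF.cfE, if_pos (by omega), smul_eq_mul] at this
      simp only [LinearMap.comp_apply]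
      linear_combination this
  suffices h : ∃ φ' : M →ₗ[L] M, AH n E cf B B' φ' ∧ DD E cf k φ' ∧
      cf (1 + k) (φ' (E 1)) = 0 ∧ cf (2 + k) (φ' (E 2)) = 0 by
    obtain ⟨φ', hA', hD', z1, z2⟩ := h
    exact ⟨φ', hA', hA'.propagate hF hB hB' hk hkn (mem_next hF hk (hD' 1 le_rfl) z1)
      (mem_next hF hk (hD' 2 (by omega)) z2)⟩
  have fin : ∀ φ' : M →ₗ[L] M, AH n E cf B B' φ' → DD E cf k φ' →
      (((1 : L) - k) * cf (1 + k) (φ' (E 1)) = 0 ∧ (k ≠ 1 → cf (1 + k) (φ' (E 1)) = 0) ∧ 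
      (k = 1 → cf (2 + k) (φ' (E 2)) = 0)) →
      cf (1 + k) (φ' (E 1)) = 0 ∧ cf (2 + k) (φ' (E 2)) = 0 := by
    intro φ' hA' hD' h
    obtain ⟨q, q5⟩ := hA'.eqs hF hB hB' hk hD'
    have e2 := q 2 (by omega) (by omega)
    have e3 := q 3 (by omega) (by omega)
    have e4 := q 4 (by omega) (by omega)
    have e5 := q5 (by omega)
    norm_num at e2 e3 e4 e5
    obtain ⟨_, h1, h2⟩ := h
    by_cases hk1 : k = 1
    · subst hk1
      have h2 := h2 rfl
      norm_num at *
      simp only [h2] at *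
      refine ⟨?_, trivial⟩
      linear_combination (-1 / 4 : L) * e4 - (1 / 2 : L) * e3 + (3 / 4 : L) * e5
    · have h1 := h1 hk1
      refine ⟨h1, ?_⟩
      simp only [h1] at *
      have hk' : ((k : L) - 1) ≠ 0 := by
        rw [sub_ne_zero]
        exact_mod_cast hk1
      have hk2 : ((k : L) ^ 2 + k + 6) ≠ 0 := by
        exact_mod_cast (by positivity : k ^ 2 + k + 6 ≠ 0)
      have : ((k : L) - 1) * ((k : L) ^ 2 + k + 6) * cf (2 + k) (φ' (E 2)) = 0 := by
        linear_combination (6 * (1 + (k : L)) - (k + 2) * (k + 3)) * e2 - (3 + (k : L)) * e3 -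
          2 * e4 + 6 * e5
      simpa [hk', hk2] using this
  by_cases hk1 : k = 1
  · subst hk1
    obtain ⟨φ', hA', hD', h⟩ := main (- cf (2 + 1) (φ (E 2)))
    refine ⟨φ', hA', hD', fin φ' hA' hD' ⟨by simp, by simp, fun _ => ?_⟩⟩
    rw [h 2 (by omega) (by omega)]
    norm_num
  · have hk' : ((1 : L) - k) ≠ 0 := by
      rw [sub_ne_zero]
      exact_mod_cast (Ne.symm hk1)
    obtain ⟨φ', hA', hD', h⟩ := main (- cf (1 + k) (φ (E 1)) / ((1 : L) - k))
    have : cf (1 + k) (φ' (E 1)) = 0 := by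
      rw [h 1 (by omega) (by omega)]
      field_simp
      simp
    refine ⟨φ', hA', hD', fin φ' hA' hD' ⟨by simp [this], fun _ => this, fun h => absurd h hk1⟩⟩

lemma ite_mem' {S : Submodule L M} {p : Prop} [Decidable p] {a b : M} (ha : p → a ∈ S)
    (hb : b ∈ S) : (if p then a else b) ∈ S := by
  split_ifs with h
  · exact ha h
  · exact hb

lemma psi7_mem (hF : Frame n E cf) {i j m : ℕ} (hm : m + 11 ≤ i + j + n) :
    psi7 L n E i j ∈ Fil cf m := by
  unfold psi7
  split_ifs
  all_goals first
    | exact Submodule.zero_mem _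
    | exact hF.E_mem (by omega)
    | exact Submodule.smul_mem _ _ (hF.E_mem (by omega))

lemma psi8_mem (hF : Frame n E cf) {i j m : ℕ} (hm : m + 11 ≤ i + j + n) :
    psi8 L n E i j ∈ Fil cf m := by
  unfold psi8
  split_ifs
  all_goals first
    | exact Submodule.zero_mem _
    | exact hF.E_mem (by omega)
    | exact Submodule.smul_mem _ _ (hF.E_mem (by omega))

lemma psi9_mem (hF : Frame n E cf) {i j m : ℕ} (hm : m + 11 ≤ i + j + n) :
    psi9 L n E i j ∈ Fil cf m := by
  unfold psi9
  split_ifs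
  all_goals first
    | exact Submodule.zero_mem _
    | exact hF.E_mem (by omega)
    | exact Submodule.smul_mem _ _ (hF.E_mem (by omega))

lemma psi10_mem (hF : Frame n E cf) {i j m : ℕ} (hm : m + 11 ≤ i + j + n) :
    psi10 L n E i j ∈ Fil cf m := by
  unfold psi10
  split_ifs
  all_goals first
    | exact Submodule.zero_mem _
    | exact hF.E_mem (by omega)
    | exact Submodule.smul_mem _ _ (hF.E_mem (by omega))

lemma psi11_mem (hF : Frame n E cf) {i j m : ℕ} (hm : m + 11 ≤ i + j + n) :
    psi11 L n E i j ∈ Fil cf m := by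
  unfold psi11
  repeat' refine ite_mem' (fun h => ?_) ?_
  all_goals first
    | exact Submodule.zero_mem _
    | exact hF.E_mem (by omega)
    | exact Submodule.smul_mem _ _ (hF.E_mem (by omega))

lemma defTerm_mem (hF : Frame n E cf) (x : Fin 5 → L) {i j m : ℕ} (hm : m + 11 ≤ i + j + n) :
    defTerm L n E x i j ∈ Fil cf m := by
  unfold defTerm
  exact Submodule.add_mem _ (Submodule.add_mem _ (Submodule.add_mem _ (Submodule.add_mem _
    (Submodule.smul_mem _ _ (psi11_mem hF hm)) (Submodule.smul_mem _ _ (psi10_mem hF hm)))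
    (Submodule.smul_mem _ _ (psi9_mem hF hm))) (Submodule.smul_mem _ _ (psi8_mem hF hm)))
    (Submodule.smul_mem _ _ (psi7_mem hF hm))

/-- the coefficient of the correction term -/
def kap (n : ℕ) (x : Fin 5 → L) : L := x 0 * (118 / 99) * ((n : L) - 2)

/-- the corrected deformation term -/
def TT (n : ℕ) (E : ℕ → M) (x : Fin 5 → L) (i j : ℕ) : M :=
  defTerm L n E x i j + if i = 3 ∧ j = 8 then kap n x • E n else 0

lemma TT_mem (hF : Frame n E cf) (x : Fin 5 → L) {i j m : ℕ} (hm : m + 11 ≤ i + j + n) :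
    TT n E x i j ∈ Fil cf m := by
  unfold TT
  refine Submodule.add_mem _ (defTerm_mem hF x hm) ?_
  split_ifs
  · exact Submodule.smul_mem _ _ (hF.E_mem (by omega))
  · exact Submodule.zero_mem _

lemma good_of (hF : Frame n E cf) {B : M →ₗ[L] M →ₗ[L] M} {T : ℕ → ℕ → M} (hn : 16 ≤ n)
    (alt : ∀ u, B u u = 0)
    (hB : ∀ i j : ℕ, 1 ≤ i → i < j → j ≤ n →
      B (E i) (E j) = ((j : L) - (i : L)) • E (i + j) + T i j)
    (hT : ∀ i j m : ℕ, m + 11 ≤ i + j + n → T i j ∈ Fil cf m)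
    (hT1 : ∀ j, T 1 j = 0) (hT23 : T 2 3 = 0) : Good n E cf B := by
  have lt : ∀ i j : ℕ, 1 ≤ i → i < j →
      B (E i) (E j) - ((j : L) - (i : L)) • E (i + j) ∈ Fil cf (i + j + 1) := by
    intro i j hi hij
    by_cases hj : j ≤ n
    · rw [hB i j hi hij hj, add_sub_cancel_left]
      exact hT i j _ (by omega)
    · rw [hF.E_zero (by omega : j = 0 ∨ n < j), hF.E_zero (by omega : i + j = 0 ∨ n < i + j)]
      simp
  refine ⟨alt, ?_, ?_, ?_⟩
  · intro i j hi hj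
    rcases lt_trichotomy i j with h | h | h
    · exact lt i j hi h
    · subst h
      rw [alt]
      simp
    · have := Submodule.neg_mem _ (lt j i hj h)
      rw [skew_of_alt alt, add_comm i j]
      convert this using 1
      module
  · intro j hj
    rcases Nat.lt_or_ge 1 j with h | h
    · by_cases hjn : j ≤ n
      · rw [hB 1 j le_rfl h hjn, hT1, add_zero, add_comm]
        simp
      · rw [hF.E_zero (by omega : j = 0 ∨ n < j), hF.E_zero (by omega : j + 1 = 0 ∨ n < j + 1)]
        simp
    · obtain rfl : j = 1 := by omega
      rw [alt]
      simp
  · rw [hB 2 3 (by omega) (by omega) (by omega), hT23]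
    norm_num

lemma defTerm_one (x : Fin 5 → L) (j : ℕ) : defTerm L n E x 1 j = 0 := by
  simp [defTerm, psi7, psi8, psi9, psi10, psi11]

lemma defTerm_23 (x : Fin 5 → L) : defTerm L n E x 2 3 = 0 := by
  simp [defTerm, psi7, psi8, psi9, psi10, psi11]

lemma TT_one (x : Fin 5 → L) (j : ℕ) : TT n E x 1 j = 0 := by
  simp [TT, defTerm_one]

lemma TT_23 (x : Fin 5 → L) : TT n E x 2 3 = 0 := by
  simp [TT, defTerm_23]

set_option linter.unusedSimpArgs false in
set_option maxHeartbeats 4000000 in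
lemma jac_basis [CharZero L] (hF : Frame n E cf) {B : M →ₗ[L] M →ₗ[L] M} (hn : 16 ≤ n)
    (alt : ∀ u, B u u = 0) (x : Fin 5 → L)
    (hB : ∀ i j : ℕ, 1 ≤ i → i < j → j ≤ n →
      B (E i) (E j) = ((j : L) - (i : L)) • E (i + j) + TT n E x i j)
    (i j k : ℕ) (hi : 1 ≤ i) (hij : i < j) (hjk : j < k) :
    B (E i) (B (E j) (E k)) + B (E j) (B (E k) (E i)) + B (E k) (B (E i) (E j)) = 0 := by
  have hG := good_of hF hn alt hB (fun i j m => TT_mem hF x) (TT_one x) (TT_23 x)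
  have sk := skew_of_alt alt
  have hlt : ∀ i j : ℕ, 1 ≤ i → i < j →
      B (E i) (E j) = ((j : L) - (i : L)) • E (i + j) + TT n E x i j := by
    intro i j hi hij
    by_cases hj : j ≤ n
    · exact hB i j hi hij hj
    · rw [hF.E_zero (by omega : j = 0 ∨ n < j), hF.E_zero (by omega : i + j = 0 ∨ n < i + j),
        hF.Fil_top (Nat.lt_succ_self n) (TT_mem hF x (by omega : n + 1 + 11 ≤ i + j + n))]
      simp
  have hbig : ∀ i j : ℕ, 1 ≤ i → 1 ≤ j → 12 ≤ i + j →
      B (E i) (E j) = ((j : L) - (i : L)) • E (i + j) := by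
    have : ∀ i j : ℕ, 1 ≤ i → i < j → 12 ≤ i + j →
      B (E i) (E j) = ((j : L) - (i : L)) • E (i + j) := by
      intro i j hi hij h
      rw [hlt i j hi hij,
        hF.Fil_top (Nat.lt_succ_self n) (TT_mem hF x (by omega : n + 1 + 11 ≤ i + j + n)), add_zero]
    intro i j hi hj h
    rcases lt_trichotomy i j with h' | h' | h'
    · exact this i j hi h' h
    · subst h'
      rw [alt]
      simp
    · rw [sk, this j i hj h' (by omega), add_comm i j]
      module
  by_cases hs : 12 ≤ i + j + k
  · have hT : ∀ a b c : ℕ, 1 ≤ a → 1 ≤ b → 1 ≤ c → a + b + c = i + j + k →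
        B (E a) (TT n E x b c) = 0 := by
      intro a b c ha hb hc h
      refine hF.Fil_top (Nat.lt_succ_self n) (Fil_anti ?_ (hG.fil hF (j := b + c + n - 11) ha
        (by omega) (hF.E_mem (le_refl a)) (TT_mem hF x (by omega))))
      omega
    rw [sk (E k) (E i), hlt j k (by omega) hjk, hlt i k hi (by omega), hlt i j hi hij]
    simp only [map_add, map_smul, map_neg]
    rw [hT i j k, hT j i k, hT k i j, hbig i (j + k), hbig j (i + k), hbig k (i + j)]
    any_goals omega
    rw [show i + (j + k) = i + j + k by omega, show j + (i + k) = i + j + k by omega,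
      show k + (i + j) = i + j + k by omega]
    push_cast
    module
  · have hlt' : ∀ i j : ℕ, 1 ≤ i → i < j → j ≤ 11 →
        B (E i) (E j) = ((j : L) - (i : L)) • E (i + j) + TT n E x i j :=
      fun i j hi hij _ => hlt i j hi hij
    have hgt : ∀ i j : ℕ, 1 ≤ j → j < i → i ≤ 11 →
        B (E i) (E j) = - (((i : L) - (j : L)) • E (j + i) + TT n E x j i) := by
      intro i j hi hij _
      rw [sk, hlt j i hi hij]
    obtain ⟨N, rfl⟩ : ∃ N, n = N + 16 := ⟨n - 16, by omega⟩
    have b12 : ∀ i, 1 ≤ i → B (E i) (E (N + 12)) = ((N : L) + 12 - i) • E (N + (12 + i)) := by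
      intro i hi
      rw [hbig i _ hi (by omega) (by omega), show i + (N + 12) = N + (12 + i) by omega]
      push_cast; rfl
    have b13 : ∀ i, 1 ≤ i → B (E i) (E (N + 13)) = ((N : L) + 13 - i) • E (N + (13 + i)) := by
      intro i hi
      rw [hbig i _ hi (by omega) (by omega), show i + (N + 13) = N + (13 + i) by omega]
      push_cast; rfl
    have b14 : ∀ i, 1 ≤ i → B (E i) (E (N + 14)) = ((N : L) + 14 - i) • E (N + (14 + i)) := by
      intro i hi
      rw [hbig i _ hi (by omega) (by omega), show i + (N + 14) = N + (14 + i) by omega]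
      push_cast; rfl
    have b15 : ∀ i, 1 ≤ i → B (E i) (E (N + 15)) = ((N : L) + 15 - i) • E (N + (15 + i)) := by
      intro i hi
      rw [hbig i _ hi (by omega) (by omega), show i + (N + 15) = N + (15 + i) by omega]
      push_cast; rfl
    have b16 : ∀ i, 1 ≤ i → B (E i) (E (N + 16)) = 0 := by
      intro i hi
      rw [hbig i _ hi (by omega) (by omega), hF.E_zero (by omega), smul_zero]
    have z : ∀ i, 17 ≤ i → E (N + i) = 0 := fun i hi => hF.E_zero (by omega)
    have hi4 : i ≤ 2 := by omega
    have hj4 : j ≤ 4 := by omega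
    have hk4 : k ≤ 8 := by omega
    interval_cases i <;> interval_cases j <;> interval_cases k <;> first | omega | skip
    all_goals
      simp [hlt', hgt, alt, TT, defTerm, psi7, psi8, psi9, psi10, psi11, b12, b13, b14, b15, b16, z]
    all_goals try simp only [P1, P2, P3, Q1, Q2, Q3, Z1, Z2, Z3, Z4, ch2, ch3, ch4, kap]
    all_goals try push_cast
    all_goals match_scalars <;> first | ring1 | (field_simp; ring1)

lemma lin_ext (hF : Frame n E cf) {N : Type*} [AddCommGroup N] [Module L N] {f f' : M →ₗ[L] N}
    (h : ∀ i, 1 ≤ i → i ≤ n → f (E i) = f' (E i)) : f = f' := by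
  ext v
  rw [hF.dec v, map_sum, map_sum]
  refine Finset.sum_congr rfl fun k hk => ?_
  rw [map_smul, map_smul]
  rcases Nat.eq_zero_or_pos k with h0 | h0
  · rw [hF.E_zero (Or.inl h0), map_zero, map_zero]
  · rw [h k h0 (by simp at hk; omega)]

lemma bil_ext (hF : Frame n E cf) {B B' : M →ₗ[L] M →ₗ[L] M} (alt : ∀ u, B u u = 0)
    (alt' : ∀ u, B' u u = 0)
    (h : ∀ i j : ℕ, 1 ≤ i → i < j → j ≤ n → B (E i) (E j) = B' (E i) (E j)) : B = B' := by
  refine lin_ext hF fun i hi hin => lin_ext hF fun j hj hjn => ?_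
  rcases lt_trichotomy i j with h' | h' | h'
  · exact h i j hi h' hjn
  · rw [h', alt, alt']
  · rw [skew_of_alt alt, skew_of_alt alt', h j i hj h' hin]

lemma jac_full [CharZero L] (hF : Frame n E cf) {B : M →ₗ[L] M →ₗ[L] M} (hn : 16 ≤ n)
    (alt : ∀ u, B u u = 0) (x : Fin 5 → L)
    (hB : ∀ i j : ℕ, 1 ≤ i → i < j → j ≤ n →
      B (E i) (E j) = ((j : L) - (i : L)) • E (i + j) + TT n E x i j) (a b c : M) :
    B a (B b c) + B b (B c a) + B c (B a b) = 0 := by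
  have sk := skew_of_alt alt
  have h0 := jac_basis hF hn alt x hB
  have hb : ∀ i j k : ℕ, 1 ≤ i → 1 ≤ j → 1 ≤ k → 
      B (E i) (B (E j) (E k)) + B (E j) (B (E k) (E i)) + B (E k) (B (E i) (E j)) = 0 := by
    have two : ∀ u v : M, B u (B u v) + B u (B v u) + B v (B u u) = 0 := by
      intro u v
      rw [sk v u, alt]
      simp
    have sw : ∀ i j k : ℕ, 
      B (E i) (B (E j) (E k)) + B (E j) (B (E k) (E i)) + B (E k) (B (E i) (E j)) = 0 →
      B (E j) (B (E i) (E k)) + B (E i) (B (E k) (E j)) + B (E k) (B (E j) (E i)) = 0 := by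
      intro i j k h
      rw [sk (E i) (E k), sk (E k) (E j), sk (E j) (E i)]
      simp only [map_neg]
      rw [← neg_eq_zero]
      rw [← h]
      abel
    have cy : ∀ i j k : ℕ, 
      B (E i) (B (E j) (E k)) + B (E j) (B (E k) (E i)) + B (E k) (B (E i) (E j)) = 0 →
      B (E j) (B (E k) (E i)) + B (E k) (B (E i) (E j)) + B (E i) (B (E j) (E k)) = 0 := by
      intro i j k h
      rw [← h]
      abel
    intro i j k hi hj hk
    by_cases hij : i = j
    · subst hij; exact two _ _
    by_cases hjk : j = k
    · subst hjk
      exact cy _ _ _ (cy _ _ _ (two _ _))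
    by_cases hik : i = k
    · subst hik
      exact cy _ _ _ (two _ _)
    rcases Nat.lt_or_gt_of_ne hij with h1 | h1 <;> rcases Nat.lt_or_gt_of_ne hjk with h2 | h2 <;>
      rcases Nat.lt_or_gt_of_ne hik with h3 | h3
    · exact h0 i j k hi h1 h2
    · omega
    · exact cy _ _ _ (sw _ _ _ (h0 i k j hi h3 h2))
    · exact cy _ _ _ (h0 k i j hk h3 h1)
    · exact sw _ _ _ (h0 j i k hj h1 h3)
    · exact cy _ _ _ (cy _ _ _ (h0 j k i hj h2 h3))
    · omega
    · exact cy _ _ _ (cy _ _ _ (sw _ _ _ (h0 k j i hk h2 h1)))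
  have s1 : ∀ j k : ℕ, 1 ≤ j → 1 ≤ k → ∀ a, 
      B a (B (E j) (E k)) + B (E j) (B (E k) a) + B (E k) (B a (E j)) = 0 := by
    intro j k hj hk
    have := lin_ext hF (f := B.flip (B (E j) (E k)) + (B (E j)) ∘ₗ (B (E k)) +
      (B (E k)) ∘ₗ (B.flip (E j))) (f' := 0) (fun i hi _ => by
        simpa using hb i j k hi hj hk)
    intro a
    simpa using LinearMap.congr_fun this a
  have s2 : ∀ k : ℕ, 1 ≤ k → ∀ a b, 
      B a (B b (E k)) + B b (B (E k) a) + B (E k) (B a b) = 0 := by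
    intro k hk a
    have := lin_ext hF (f := (B a) ∘ₗ (B.flip (E k)) + B.flip (B (E k) a) +
      (B (E k)) ∘ₗ (B a)) (f' := 0) (fun j hj _ => by
        simpa using s1 j k hj hk a)
    intro b
    simpa using LinearMap.congr_fun this b
  have := lin_ext hF (f := (B a) ∘ₗ (B b) + (B b) ∘ₗ (B.flip a) + B.flip (B a b))
    (f' := 0) (fun k hk _ => by simpa using s2 k hk a b)
  simpa using LinearMap.congr_fun this c

/-- the scalar alternating form `e^3 ∧ e^8` -/
def be (cf : ℕ → M →ₗ[L] L) (a b : M) : L := cf 3 a * cf 8 b - cf 8 a * cf 3 b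

/-- the corrected bracket -/
def Bt (n : ℕ) (E : ℕ → M) (cf : ℕ → M →ₗ[L] L) (x : Fin 5 → L) (B : M →ₗ[L] M →ₗ[L] M) :
    M →ₗ[L] M →ₗ[L] M :=
  LinearMap.mk₂ L (fun a b => B a b + (kap n x * be cf a b) • E n)
    (by intro a a' b; simp only [be, map_add, LinearMap.add_apply]; module)
    (by intro c a b; simp only [be, map_smul, LinearMap.smul_apply, smul_eq_mul]; module)
    (by intro a b b'; simp only [be, map_add]; module)
    (by intro c a b; simp only [be, map_smul, smul_eq_mul]; module)

lemma Bt_apply (x : Fin 5 → L) (B : M →ₗ[L] M →ₗ[L] M) (a b : M) :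
    Bt n E cf x B a b = B a b + (kap n x * be cf a b) • E n := rfl

lemma Bt_alt (x : Fin 5 → L) {B : M →ₗ[L] M →ₗ[L] M} (alt : ∀ u, B u u = 0) (u : M) :
    Bt n E cf x B u u = 0 := by
  rw [Bt_apply, alt, be]
  simp [mul_comm]

lemma Bt_def (hF : Frame n E cf) {B : M →ₗ[L] M →ₗ[L] M} (hn : 16 ≤ n) (x : Fin 5 → L)
    (hB : ∀ i j : ℕ, 1 ≤ i → i < j → j ≤ n →
      B (E i) (E j) = ((j : L) - (i : L)) • E (i + j) + defTerm L n E x i j) :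
    ∀ i j : ℕ, 1 ≤ i → i < j → j ≤ n →
      Bt n E cf x B (E i) (E j) = ((j : L) - (i : L)) • E (i + j) + TT n E x i j := by
  intro i j hi hij hj
  rw [Bt_apply, hB i j hi hij hj, TT, add_assoc]
  congr 2
  by_cases h : i = 3 ∧ j = 8
  · obtain ⟨rfl, rfl⟩ := h
    have h3 : cf 3 (E 3) = 1 := by rw [hF.cfE, if_pos (by omega)]
    have h8 : cf 8 (E 8) = 1 := by rw [hF.cfE, if_pos (by omega)]
    have h38 : cf 3 (E 8) = 0 := by rw [hF.cfE, if_neg (by omega)]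
    simp [be, h3, h8, h38]
  · rw [if_neg h]
    have : be cf (E i) (E j) = 0 := by
      unfold be
      simp only [hF.cfE]
      by_cases h3 : 3 = i
      · rw [if_neg (by omega : ¬ (8 = j ∧ 1 ≤ 8 ∧ 8 ≤ n)), if_neg (by omega : ¬ (3 = j ∧ 1 ≤ 3 ∧ 3 ≤ n))]
        simp
      · rw [if_neg (by omega : ¬ (3 = i ∧ 1 ≤ 3 ∧ 3 ≤ n))]
        by_cases h8 : 8 = i
        · rw [if_neg (by omega : ¬ (3 = j ∧ 1 ≤ 3 ∧ 3 ≤ n))]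
          simp
        · rw [if_neg (by omega : ¬ (8 = i ∧ 1 ≤ 8 ∧ 8 ≤ n))]
          simp
    rw [this]
    simp

lemma jac_B [CharZero L] (hF : Frame n E cf) {B : M →ₗ[L] M →ₗ[L] M} (hn : 16 ≤ n)
    (alt : ∀ u, B u u = 0) (x : Fin 5 → L)
    (hB : ∀ i j : ℕ, 1 ≤ i → i < j → j ≤ n →
      B (E i) (E j) = ((j : L) - (i : L)) • E (i + j) + defTerm L n E x i j) (a b c : M) :
    B a (B b c) + B b (B c a) + B c (B a b) =
      -(kap n x * (be cf a (B b c) + be cf b (B c a) + be cf c (B a b))) • E n := by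
  have hG := good_of hF hn alt hB (fun i j m => defTerm_mem hF x) (defTerm_one x) (defTerm_23 x)
  have cen : ∀ a, B a (E n) = 0 := fun a =>
    hF.Fil_top (by omega) (hG.fil hF le_rfl (by omega) (hF.mem_one a) (hF.E_mem (le_refl n)))
  have e3 : cf 3 (E n) = 0 := by rw [hF.cfE, if_neg (by omega)]
  have e8 : cf 8 (E n) = 0 := by rw [hF.cfE, if_neg (by omega)]
  have be0 : ∀ a, be cf a (E n) = 0 := by
    intro a
    simp [be, e3, e8]
  have bea : ∀ (a b : M) (r : L), be cf a (b + r • E n) = be cf a b := by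
    intro a b r
    simp [be, e3, e8]
  have J := jac_full hF hn (Bt_alt x alt) x (Bt_def hF hn x hB) a b c
  simp only [Bt_apply] at J
  simp only [bea, map_add, map_smul, cen, smul_zero, add_zero] at J
  rw [← sub_eq_zero, ← J]
  module

lemma DD.cf_lt {φ : M →ₗ[L] M} {k : ℕ} (hD : DD E cf k φ) {i j : ℕ} (hj : 1 ≤ j) (h : i < j + k) :
    cf i (φ (E j)) = cf i (E j) := by
  have := hD j hj i h
  rwa [map_sub, sub_eq_zero] at this

lemma DD.fil (hF : Frame n E cf) {φ : M →ₗ[L] M} {k : ℕ} (hD : DD E cf k φ) {j : ℕ} {v : M}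
    (hv : v ∈ Fil cf j) : φ v ∈ Fil cf j := by
  rw [hF.dec v, map_sum]
  refine Submodule.sum_mem _ fun a ha => ?_
  rw [map_smul]
  by_cases haj : a < j
  · rw [hv a haj, zero_smul]; exact Submodule.zero_mem _
  refine Submodule.smul_mem _ _ ?_
  rcases Nat.eq_zero_or_pos a with h0 | h0
  · rw [hF.E_zero (Or.inl h0), map_zero]; exact Submodule.zero_mem _
  have := Submodule.add_mem _ (Fil_anti (show j ≤ a + k by omega) (hD a h0))
    (hF.E_mem (show j ≤ a by omega))
  simpa using this

lemma be_zero {a b : M} (ha : cf 3 a = 0) (hb : cf 3 b = 0) : be cf a b = 0 := by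
  simp [be, ha, hb]

lemma kappa_claim [CharZero L] (hF : Frame n E cf) (hn : 16 ≤ n) {x y : Fin 5 → L}
    {Bx By : M →ₗ[L] M →ₗ[L] M} (altx : ∀ u, Bx u u = 0) (alty : ∀ u, By u u = 0)
    (hBx : ∀ i j : ℕ, 1 ≤ i → i < j → j ≤ n →
      Bx (E i) (E j) = ((j : L) - (i : L)) • E (i + j) + defTerm L n E x i j)
    (hBy : ∀ i j : ℕ, 1 ≤ i → i < j → j ≤ n →
      By (E i) (E j) = ((j : L) - (i : L)) • E (i + j) + defTerm L n E y i j)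
    {φ : M →ₗ[L] M} (hφ : ∀ a b, φ (Bx a b) = By (φ a) (φ b)) (hD : DD E cf 1 φ)
    (hk : kap n y ≠ 0) : cf 3 (φ (E 1)) = 0 ∧ cf 3 (φ (E 2)) = 0 := by
  have hGx := good_of hF hn altx hBx (fun i j m => defTerm_mem hF x) (defTerm_one x) (defTerm_23 x)
  have hGy := good_of hF hn alty hBy (fun i j m => defTerm_mem hF y) (defTerm_one y) (defTerm_23 y)
  have hA : AH n E cf Bx By φ := by
    refine ⟨fun j _ _ => hφ _ _, ?_, ?_, hφ _ _⟩ <;>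
    · rw [hφ, sub_self]; exact Submodule.zero_mem _
  have En : φ (E n) = E n := by
    have := hF.Fil_top (by omega) (hD n (by omega))
    rwa [sub_eq_zero] at this
  have id : ∀ a b c, kap n y * (be cf (φ a) (φ (Bx b c)) + be cf (φ b) (φ (Bx c a)) +
      be cf (φ c) (φ (Bx a b))) =
      kap n x * (be cf a (Bx b c) + be cf b (Bx c a) + be cf c (Bx a b)) := by
    intro a b c
    have h1 := congrArg φ (jac_B hF hn altx x hBx a b c)
    have h2 := jac_B hF hn alty y hBy (φ a) (φ b) (φ c)
    simp only [map_add, map_smul, En, hφ] at h1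
    rw [h2] at h1
    have := congrArg (cf n) h1
    simp only [map_smul, smul_eq_mul] at this
    rw [hF.cfE, if_pos (by omega)] at this
    simp only [hφ]
    linear_combination -this
  have z : ∀ {m i : ℕ} {v : M}, v ∈ Fil cf m → i < m → cf i v = 0 := fun h h' => h _ h'
  have eE : ∀ i j, i ≠ j → cf i (E j) = 0 := by
    intro i j h
    rw [hF.cfE, if_neg (by omega)]
  have eE1 : ∀ i, 1 ≤ i → i ≤ n → cf i (E i) = 1 := by
    intro i h h'
    rw [hF.cfE, if_pos (by omega)]
  obtain ⟨q1, q5⟩ := hA.eqs hF hGx hGy le_rfl hD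
  have e2 := q1 2 (by omega) (by omega)
  have e3 := q1 3 (by omega) (by omega)
  have e4 := q1 4 (by omega) (by omega)
  have e5 := q1 5 (by omega) (by omega)
  have e6 := q1 6 (by omega) (by omega)
  have e0 := q5 (by omega)
  norm_num at e2 e3 e4 e5 e6 e0
  have a1 : cf 2 (φ (E 1)) = 0 := by
    linear_combination (1/4 : L) * (-e4 - 2 * e3 + 3 * e0)
  have r6 : cf 8 (φ (E 7)) = 6 * cf 3 (φ (E 2)) := by
    rw [a1] at e3 e4 e5 e6
    linear_combination (1/5 : L) * e6 + (6/20 : L) * e5 + (30/20 : L) * e0 + (60/20 : L) * e2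
  have T1 := id (E 1) (E 2) (E 7)
  have q0 : cf 3 (φ (E 2)) = 0 := by
    have m1 : Bx (E 2) (E 7) ∈ Fil cf 9 :=
      hGx.fil hF (by omega) (by omega) (hF.E_mem (le_refl 2)) (hF.E_mem (le_refl 7))
    have m2 : Bx (E 7) (E 1) = (-6 : L) • E 8 := by
      rw [skew_of_alt altx, hGx.one 7 (by omega)]
      norm_num
    have m3 : Bx (E 1) (E 2) = E 3 := by
      rw [hGx.one 2 (by omega)]
      norm_num
    have m1' := hD.fil hF m1
    rw [m2, m3] at T1
    simp only [be, map_smul, z m1 (show 3 < 9 by omega), z m1 (show 8 < 9 by omega),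
      z m1' (show 3 < 9 by omega), z m1' (show 8 < 9 by omega), smul_eq_mul,
      hD.cf_lt (show 1 ≤ 8 by omega) (show 3 < 8 + 1 by omega),
      hD.cf_lt (show 1 ≤ 8 by omega) (show 8 < 8 + 1 by omega),
      hD.cf_lt (show 1 ≤ 7 by omega) (show 3 < 7 + 1 by omega),
      hD.cf_lt (show 1 ≤ 3 by omega) (show 3 < 3 + 1 by omega),
      eE 3 8 (by omega), eE 3 7 (by omega), eE1 8 (by omega) (by omega),
      eE1 3 (by omega) (by omega), eE 3 2 (by omega), eE 8 2 (by omega), eE 8 7 (by omega), r6] at T1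
    have : kap n y * (12 * cf 3 (φ (E 2))) = 0 := by linear_combination -T1
    rcases mul_eq_zero.mp this with h | h
    · exact absurd h hk
    · rcases mul_eq_zero.mp h with h | h
      · norm_num at h
      · exact h
  refine ⟨?_, q0⟩
  have hD2 : DD E cf 2 φ := hA.propagate hF hGx hGy le_rfl (by omega)
    (mem_next hF le_rfl (hD 1 (by omega)) a1) (mem_next hF le_rfl (hD 2 (by omega)) q0)
  obtain ⟨q1, q5⟩ := hA.eqs hF hGx hGy (by omega) hD2
  have e2 := q1 2 (by omega) (by omega)
  have e3 := q1 3 (by omega) (by omega)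
  have e4 := q1 4 (by omega) (by omega)
  have e5 := q1 5 (by omega) (by omega)
  have e0 := q5 (by omega)
  norm_num at e2 e3 e4 e5 e0
  have T2 := id (E 2) (E 3) (E 4)
  have a6 : cf 8 (φ (E 6)) = 0 := by
    have m1 : Bx (E 3) (E 4) ∈ Fil cf 7 :=
      hGx.fil hF (by omega) (by omega) (hF.E_mem (le_refl 3)) (hF.E_mem (le_refl 4))
    have m1' := hD.fil hF m1
    have m2 : Bx (E 4) (E 2) = (-2 : L) • E 6 - defTerm L n E x 2 4 := by
      rw [skew_of_alt altx, hBx 2 4 (by omega) (by omega) (by omega)]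
      norm_num
      abel
    have m3 : Bx (E 2) (E 3) = E 5 := hGx.two3
    have m4 : defTerm L n E x 2 4 ∈ Fil cf 9 := defTerm_mem hF x (by omega)
    have m4' := hD.fil hF m4
    rw [m2, m3] at T2
    simp only [be, map_smul, map_sub, z m1 (show 3 < 7 by omega), 
      z m1' (show 3 < 7 by omega), z m4 (show 3 < 9 by omega), z m4 (show 8 < 9 by omega),
      z m4' (show 3 < 9 by omega), z m4' (show 8 < 9 by omega), smul_eq_mul, q0,
      hD.cf_lt (show 1 ≤ 3 by omega) (show 3 < 3 + 1 by omega),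
      hD.cf_lt (show 1 ≤ 4 by omega) (show 3 < 4 + 1 by omega),
      hD.cf_lt (show 1 ≤ 5 by omega) (show 3 < 5 + 1 by omega),
      hD.cf_lt (show 1 ≤ 6 by omega) (show 3 < 6 + 1 by omega),
      eE 3 2 (by omega), eE 3 4 (by omega), eE 3 5 (by omega), eE 3 6 (by omega), eE 8 6 (by omega),
      eE 8 4 (by omega), eE 8 3 (by omega), eE1 3 (by omega) (by omega)] at T2
    have : kap n y * (2 * cf 8 (φ (E 6))) = 0 := by linear_combination -T2
    rcases mul_eq_zero.mp this with h | h
    · exact absurd h hk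
    · rcases mul_eq_zero.mp h with h | h
      · norm_num at h
      · exact h
  rw [a6] at e5
  clear T2 T1 id q1 q5 hBx hBy
  grind

lemma core [CharZero L] (hF : Frame n E cf) (hn : 16 ≤ n) {x y : Fin 5 → L}
    {Bx By : M →ₗ[L] M →ₗ[L] M} (altx : ∀ u, Bx u u = 0) (alty : ∀ u, By u u = 0)
    (hBx : ∀ i j : ℕ, 1 ≤ i → i < j → j ≤ n →
      Bx (E i) (E j) = ((j : L) - (i : L)) • E (i + j) + defTerm L n E x i j)
    (hBy : ∀ i j : ℕ, 1 ≤ i → i < j → j ≤ n →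
      By (E i) (E j) = ((j : L) - (i : L)) • E (i + j) + defTerm L n E y i j)
    {φ : M →ₗ[L] M} (hφ : ∀ a b, φ (Bx a b) = By (φ a) (φ b)) (hD : DD E cf 1 φ) : x = y := by
  have hGx := good_of hF hn (Bt_alt x altx) (Bt_def hF hn x hBx) (fun i j m => TT_mem hF x)
    (TT_one x) (TT_23 x)
  have hGy := good_of hF hn (Bt_alt y alty) (Bt_def hF hn y hBy) (fun i j m => TT_mem hF y)
    (TT_one y) (TT_23 y)
  have hJ : ∀ a b c, Bt n E cf y By a (Bt n E cf y By b c) =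
      Bt n E cf y By b (Bt n E cf y By a c) + Bt n E cf y By (Bt n E cf y By a b) c := by
    intro a b c
    have := jac_full hF hn (Bt_alt y alty) y (Bt_def hF hn y hBy) a b c
    rw [skew_of_alt (Bt_alt y alty) c (Bt n E cf y By a b), skew_of_alt (Bt_alt y alty) c a,
      map_neg] at this
    rw [← sub_eq_zero, ← this]
    abel
  have En : φ (E n) = E n := by
    have := hF.Fil_top (by omega) (hD n (by omega))
    rwa [sub_eq_zero] at this
  have key : ∀ a b, φ (Bt n E cf x Bx a b) = Bt n E cf y By (φ a) (φ b) +
      (kap n x * be cf a b - kap n y * be cf (φ a) (φ b)) • E n := by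
    intro a b
    rw [Bt_apply, Bt_apply, map_add, map_smul, En, hφ]
    module
  have eE : ∀ i j, i ≠ j → cf i (E j) = 0 := by
    intro i j h
    rw [hF.cfE, if_neg (by omega)]
  have z4 : ∀ j, 4 ≤ j → cf 3 (φ (E j)) = 0 := by
    intro j hj
    rw [hD.cf_lt (by omega) (by omega), eE 3 j (by omega)]
  have ky : ∀ i j, (i = 1 ∨ i = 2) → (j = 2 ∨ 4 ≤ j) →
      kap n y * be cf (φ (E i)) (φ (E j)) = 0 := by
    intro i j hi hj
    by_cases hk : kap n y = 0
    · rw [hk, zero_mul]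
    obtain ⟨p, q⟩ := kappa_claim hF hn altx alty hBx hBy hφ hD hk
    rw [be_zero, mul_zero]
    · rcases hi with rfl | rfl
      · exact p
      · exact q
    · rcases hj with rfl | hj
      · exact q
      · exact z4 j hj
  have ex : ∀ i j, (i = 1 ∨ i = 2) → (j = 2 ∨ 4 ≤ j) →
      φ (Bt n E cf x Bx (E i) (E j)) = Bt n E cf y By (φ (E i)) (φ (E j)) := by
    intro i j hi hj
    rw [key, ky i j hi hj, be_zero (eE _ _ (by omega)) (eE _ _ (by omega))]
    simp
  have ap : ∀ a b, φ (Bt n E cf x Bx a b) - Bt n E cf y By (φ a) (φ b) ∈ Fil cf n := by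
    intro a b
    rw [key, add_sub_cancel_left]
    exact Submodule.smul_mem _ _ (hF.E_mem le_rfl)
  have hA : AH n E cf (Bt n E cf x Bx) (Bt n E cf y By) φ :=
    ⟨fun j h2 h3 => ex 1 j (Or.inl rfl) (by omega), ap _ _, ap _ _,
      ex 2 5 (Or.inr rfl) (by omega)⟩
  have it : ∀ k, 1 ≤ k → k + 6 ≤ n → ∃ φ' : M →ₗ[L] M,
      AH n E cf (Bt n E cf x Bx) (Bt n E cf y By) φ' ∧ DD E cf k φ' := by
    intro k hk
    induction k, hk using Nat.le_induction with
    | base => intro _; exact ⟨φ, hA, hD⟩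
    | succ k hk ih =>
      intro hkn
      obtain ⟨φ', h1, h2⟩ := ih (by omega)
      exact AH.step hF hGx hGy hJ hk (by omega) h1 h2
  obtain ⟨ψ, hA', hD'⟩ := it (n - 6) (by omega) (by omega)
  have fx : ∀ j, 7 ≤ j → ψ (E j) = E j := by
    intro j hj
    have := hF.Fil_top (by omega) (hD' j (by omega))
    rwa [sub_eq_zero] at this
  have h25 := hA'.two5
  have r : Bt n E cf y By (ψ (E 2)) (ψ (E 5)) = Bt n E cf y By (E 2) (E 5) := by
    have t1 : Bt n E cf y By (ψ (E 2) - E 2) (ψ (E 5)) = 0 := by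
      refine hF.Fil_top ?_ (hGy.fil hF (by omega) (show 1 ≤ 5 by omega) (hD' 2 (by omega)) 
        (hD'.fil hF (hF.E_mem (le_refl 5))))
      omega
    have t2 : Bt n E cf y By (E 2) (ψ (E 5) - E 5) = 0 := by
      refine hF.Fil_top ?_ (hGy.fil hF (by omega) (by omega) (hF.E_mem (le_refl 2))
        (hD' 5 (by omega)))
      omega
    rw [map_sub, LinearMap.sub_apply, sub_eq_zero] at t1
    rw [map_sub, sub_eq_zero] at t2
    rw [t1, t2]
  have d25 : ∀ x : Fin 5 → L, TT n E x 2 5 = x 0 • E (n - 4) + x 1 • E (n - 3) + x 2 • E (n - 2)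
      + x 3 • E (n - 1) + x 4 • E n := by
    intro x
    simp [TT, defTerm, psi7, psi8, psi9, psi10, psi11]
  rw [r, Bt_def hF hn x hBx 2 5 (by omega) (by omega) (by omega),
    Bt_def hF hn y hBy 2 5 (by omega) (by omega) (by omega), d25, d25] at h25
  simp only [map_add, map_smul, fx 7 (by omega), fx n (by omega), fx (n - 1) (by omega),
    fx (n - 2) (by omega), fx (n - 3) (by omega), fx (n - 4) (by omega), Nat.reduceAdd,
    add_right_inj] at h25
  have c : ∀ i : Fin 5, x i = y i := by
    have cc : ∀ s, s ≤ 4 → ∀ x : Fin 5 → L, cf (n - s) (x 0 • E (n - 4) + x 1 • E (n - 3) + x 2 • E (n - 2)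
      + x 3 • E (n - 1) + x 4 • E n) = if s = 0 then x 4 else if s = 1 then x 3 else if s = 2 then x 2 else 
        if s = 3 then x 1 else x 0 := by
      intro s hs x
      have hE : ∀ t, t ≤ 4 → cf (n - s) (E (n - t)) = if s = t then 1 else 0 := by
        intro t ht
        rw [hF.cfE]
        exact if_congr (by omega) rfl rfl
      have hE0 := hE 0 (by omega)
      rw [Nat.sub_zero] at hE0
      simp only [map_add, map_smul, hE 4 (by omega), hE 3 (by omega), hE 2 (by omega),
        hE 1 (by omega), hE0]
      interval_cases s <;> simp
    intro i
    have := fun s (hs : s ≤ 4) => congrArg (cf (n - s)) h25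
    have g := fun s (hs : s ≤ 4) => (cc s hs x).symm.trans ((this s hs).trans (cc s hs y))
    fin_cases i
    · simpa using g 4 (by omega)
    · simpa using g 3 (by omega)
    · simpa using g 2 (by omega)
    · simpa using g 1 (by omega)
    · simpa using g 0 (by omega)
  exact funext c

lemma frame_of_basis (b : Basis (Fin n) L M) (hb : ∀ i : Fin n, E ((i : ℕ) + 1) = b i)
    (h0 : ∀ m : ℕ, m = 0 ∨ n < m → E m = 0) : ∃ cf : ℕ → M →ₗ[L] L, Frame n E cf := by
  refine ⟨fun m => if h : 1 ≤ m ∧ m ≤ n then b.coord ⟨m - 1, by omega⟩ else 0, ?_, ?_⟩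
  · intro i j
    by_cases hj : 1 ≤ j ∧ j ≤ n
    · have hE : E j = b ⟨j - 1, by omega⟩ := by
        rw [← hb]
        congr 1
        simp
        omega
      rw [hE]
      by_cases hi : 1 ≤ i ∧ i ≤ n
      · rw [dif_pos hi, Basis.coord_apply, Basis.repr_self, Finsupp.single_apply]
        refine if_congr ?_ rfl rfl
        rw [Fin.mk.injEq]
        omega
      · rw [dif_neg hi, if_neg (by omega)]
        rfl
    · rw [h0 j (by omega), map_zero, if_neg (by omega)]
  · intro v
    rw [Finset.sum_range_succ', Finset.sum_range]
    rw [h0 0 (Or.inl rfl), smul_zero, add_zero]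
    conv_lhs => rw [← b.sum_repr v]
    refine Finset.sum_congr rfl fun i _ => ?_
    rw [hb, dif_pos (by omega)]
    simp

lemma lead2 (hF : Frame n E cf) {B : M →ₗ[L] M →ₗ[L] M} (hB : Good n E cf B) {i j : ℕ} {u v : M}
    (hi : 1 ≤ i) (hj : 1 ≤ j) (hu : u ∈ Fil cf i) (hv : v ∈ Fil cf j) :
    B u v - (cf i u * cf j v * ((j : L) - i)) • E (i + j) ∈ Fil cf (i + j + 1) := by
  have ru := hF.Fil_dec hu
  have rv := hF.Fil_dec hv
  have t1 := hB.fil hF (by omega) hj ru hv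
  have t2 := hB.fil hF hi (by omega) (Submodule.smul_mem _ (cf i u) (hF.E_mem (le_refl i))) rv
  have t3 := Submodule.smul_mem _ (cf i u * cf j v) (hB.lead i j hi hj)
  have := Submodule.add_mem _ (Submodule.add_mem _ (Fil_anti (show i + j + 1 ≤ _ by omega) t1)
    (Fil_anti (show i + j + 1 ≤ _ by omega) t2)) t3
  convert this using 1
  simp only [map_sub, map_smul, LinearMap.sub_apply, LinearMap.smul_apply]
  module

lemma lead2_cf (hF : Frame n E cf) {B : M →ₗ[L] M →ₗ[L] M} (hB : Good n E cf B) {i j : ℕ} {u v : M}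
    (hi : 1 ≤ i) (hj : 1 ≤ j) (hn : i + j ≤ n) (hu : u ∈ Fil cf i) (hv : v ∈ Fil cf j) :
    cf (i + j) (B u v) = cf i u * cf j v * ((j : L) - i) := by
  have := lead2 hF hB hi hj hu hv (i + j) (by omega)
  rw [map_sub, map_smul, hF.cfE, if_pos (by omega), smul_eq_mul, mul_one, sub_eq_zero] at this
  exact this

lemma leading [CharZero L] (hF : Frame n E cf) (hn : 16 ≤ n) {Bx By : M →ₗ[L] M →ₗ[L] M}
    (hx : Good n E cf Bx) (hy : Good n E cf By) (φ : M ≃ₗ[L] M)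
    (hφ : ∀ a b, φ (Bx a b) = By (φ a) (φ b)) :
    ∃ α : L, α ≠ 0 ∧ ∀ j, 1 ≤ j → φ (E j) - α ^ j • E j ∈ Fil cf (j + 1) := by
  have one : ∀ j : ℕ, 1 ≤ j → ((j : L) - 1) • φ (E (j + 1)) = By (φ (E 1)) (φ (E j)) := by
    intro j hj
    rw [← hφ, hx.one j hj, map_smul]
  have m1 : ∀ v, v ∈ Fil cf 1 := hF.mem_one
  have cast_ne : ∀ j : ℕ, 2 ≤ j → ((j : L) - 1) ≠ 0 := by
    intro j hj h
    rw [sub_eq_zero] at h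
    have : j = 1 := by exact_mod_cast h
    omega
  have f3 : φ (E 3) ∈ Fil cf 3 := by
    have h1 := one 2 (by omega)
    have h2 := lead2 hF hy le_rfl le_rfl (m1 (φ (E 1))) (m1 (φ (E 2)))
    rw [← h1] at h2
    norm_num at h2
    exact h2
  have f : ∀ j, 3 ≤ j → φ (E j) ∈ Fil cf j := by
    intro j hj
    induction j, hj using Nat.le_induction with
    | base => exact f3
    | succ j hj ih =>
      have h := hy.fil hF le_rfl (by omega) (m1 (φ (E 1))) ih
      rw [← one j (by omega), add_comm] at h
      exact (Submodule.smul_mem_iff _ (cast_ne j (by omega))).mp h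
  set a := cf 1 (φ (E 1)) with ha
  have hrec : ∀ j, 3 ≤ j → j + 1 ≤ n → cf (j + 1) (φ (E (j + 1))) = a * cf j (φ (E j)) := by
    intro j hj hjn
    have h := lead2_cf hF hy le_rfl (by omega) (by omega) (m1 (φ (E 1))) (f j hj)
    rw [← one j (by omega), add_comm, map_smul, smul_eq_mul, Nat.cast_one] at h
    apply mul_left_cancel₀ (cast_ne j (by omega))
    rw [h]
    ring
  have dn : cf n (φ (E n)) ≠ 0 := by
    intro h
    have h1 := hF.Fil_dec (f n (by omega))
    rw [h, zero_smul, sub_zero] at h1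
    have h2 := hF.Fil_top (by omega) h1
    rw [LinearEquiv.map_eq_zero_iff] at h2
    have h3 := hF.cfE n n
    rw [h2, map_zero, if_pos (by omega)] at h3
    exact zero_ne_one h3
  have rn := hrec (n - 1) (by omega) (by omega)
  rw [Nat.sub_add_cancel (by omega)] at rn
  rw [rn] at dn
  have a0 : a ≠ 0 := left_ne_zero_of_mul dn
  have w0 := right_ne_zero_of_mul dn
  have q0 : cf 1 (φ (E 2)) = 0 := by
    have h := lead2_cf hF hy le_rfl (by omega) (by omega) (m1 (φ (E 2))) (f (n - 1) (by omega))
    rw [← hφ, hF.Fil_top (by omega) (hx.fil hF (by omega) (by omega) (hF.E_mem (le_refl 2))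
      (hF.E_mem (le_refl (n - 1)))), map_zero, map_zero, Nat.cast_one] at h
    have := cast_ne (n - 1) (by omega)
    by_contra hq
    exact mul_ne_zero (mul_ne_zero hq w0) this h.symm
  have f2 : φ (E 2) ∈ Fil cf 2 := by
    have := hF.Fil_dec (m1 (φ (E 2)))
    rwa [q0, zero_smul, sub_zero] at this
  set b := cf 2 (φ (E 2)) with hb
  have d3 : cf 3 (φ (E 3)) = a * b := by
    have h := lead2_cf hF hy le_rfl (by omega) (by omega) (m1 (φ (E 1))) f2
    rw [← one 2 (by omega)] at h
    norm_num at h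
    exact h
  have d4 := hrec 3 (by omega) (by omega)
  have d5 := hrec 4 (by omega) (by omega)
  have d5' : cf 5 (φ (E 5)) = b * cf 3 (φ (E 3)) := by
    have h := lead2_cf hF hy (by omega) (by omega) (by omega) f2 (f 3 (by omega))
    rw [← hφ, hx.two3] at h
    norm_num at h
    exact h
  norm_num at d4 d5
  have form : ∀ j, 3 ≤ j → j ≤ n → cf j (φ (E j)) = a ^ (j - 2) * b := by
    intro j hj
    induction j, hj using Nat.le_induction with
    | base => intro _; rw [d3]; norm_num
    | succ j hj ih =>
      intro h
      rw [hrec j hj h, ih (by omega), show j + 1 - 2 = (j - 2) + 1 by omega, pow_succ]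
      ring
  have b0 : b ≠ 0 := by
    intro h
    rw [form (n - 1) (by omega) (by omega), h, mul_zero] at w0
    exact w0 rfl
  have ba : b = a ^ 2 := by
    rw [d5', d4, d3] at d5
    have : (a * b) * b = (a * b) * a ^ 2 := by linear_combination d5
    exact mul_left_cancel₀ (mul_ne_zero a0 b0) this
  have fin : ∀ j, 1 ≤ j → j ≤ n → cf j (φ (E j)) = a ^ j := by
    intro j hj hjn
    by_cases h3 : 3 ≤ j
    · rw [form j h3 hjn, ba, ← pow_add]
      congr 1
      omega
    · have : j = 1 ∨ j = 2 := by omega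
      rcases this with rfl | rfl
      · rw [pow_one]
      · exact ba
  refine ⟨a, a0, fun j hj => ?_⟩
  by_cases hjn : j ≤ n
  · rw [← fin j hj hjn]
    refine hF.Fil_dec ?_
    by_cases h3 : 3 ≤ j
    · exact f j h3
    · have : j = 1 ∨ j = 2 := by omega
      rcases this with rfl | rfl
      · exact m1 _
      · exact f2
  · rw [hF.E_zero (by omega), map_zero, smul_zero, sub_zero]
    exact Submodule.zero_mem _
/-- diagonal scaling -/
def SS (n : ℕ) (E : ℕ → M) (cf : ℕ → M →ₗ[L] L) (α : L) : M →ₗ[L] M :=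
  ∑ k ∈ Finset.range (n + 1), (α ^ k) • (cf k).smulRight (E k)

lemma SS_E (hF : Frame n E cf) (α : L) (j : ℕ) : SS n E cf α (E j) = α ^ j • E j := by
  by_cases hj : j = 0 ∨ n < j
  · rw [hF.E_zero hj, map_zero, smul_zero]
  · unfold SS
    rw [LinearMap.sum_apply, Finset.sum_eq_single j]
    · rw [LinearMap.smul_apply, LinearMap.smulRight_apply, hF.cfE, if_pos (by omega), one_smul]
    · intro k _ hk
      rw [LinearMap.smul_apply, LinearMap.smulRight_apply, hF.cfE, if_neg (by omega), zero_smul,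
        smul_zero]
    · intro h
      simp at h
      omega

lemma SS_inv (hF : Frame n E cf) {α β : L} (h : α * β = 1) (v : M) :
    SS n E cf α (SS n E cf β v) = v := by
  have : SS n E cf α ∘ₗ SS n E cf β = LinearMap.id := by
    refine lin_ext hF fun i _ _ => ?_
    rw [LinearMap.comp_apply, SS_E hF, map_smul, SS_E hF, smul_smul, ← mul_pow, mul_comm β, h,
      one_pow, one_smul, LinearMap.id_apply]
  exact LinearMap.congr_fun this v

lemma ite_sc {S : M →ₗ[L] M} {c : L} {p : Prop} [Decidable p] {a b : M} (ha : p → S a = c • a)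
    (hb : ¬p → S b = c • b) : S (if p then a else b) = c • (if p then a else b) := by
  split_ifs with h
  · exact ha h
  · exact hb h

lemma sc_E (hF : Frame n E cf) (α : L) {m e : ℕ} (h : m = e) :
    SS n E cf α (E m) = α ^ e • E m := by
  rw [SS_E hF, h]

lemma sc_sE (hF : Frame n E cf) (α r : L) {m e : ℕ} (h : m = e) :
    SS n E cf α (r • E m) = α ^ e • r • E m := by
  rw [map_smul, SS_E hF, h, smul_comm]

lemma sc_0 {S : M →ₗ[L] M} {c : L} : S 0 = c • 0 := by simp

lemma psi7_sc (hF : Frame n E cf) (hn : 16 ≤ n) (α : L) (i j : ℕ) :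
    SS n E cf α (psi7 L n E i j) = α ^ (i + j + (n - 7)) • psi7 L n E i j := by
  unfold psi7
  repeat' refine ite_sc (fun h => ?_) (fun _ => ?_)
  all_goals first
    | exact sc_0
    | exact sc_E hF α (by omega)
    | exact sc_sE hF α _ (by omega)

lemma psi8_sc (hF : Frame n E cf) (hn : 16 ≤ n) (α : L) (i j : ℕ) :
    SS n E cf α (psi8 L n E i j) = α ^ (i + j + (n - 8)) • psi8 L n E i j := by
  unfold psi8
  repeat' refine ite_sc (fun h => ?_) (fun _ => ?_)
  all_goals first
    | exact sc_0
    | exact sc_E hF α (by omega)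
    | exact sc_sE hF α _ (by omega)

lemma psi9_sc (hF : Frame n E cf) (hn : 16 ≤ n) (α : L) (i j : ℕ) :
    SS n E cf α (psi9 L n E i j) = α ^ (i + j + (n - 9)) • psi9 L n E i j := by
  unfold psi9
  repeat' refine ite_sc (fun h => ?_) (fun _ => ?_)
  all_goals first
    | exact sc_0
    | exact sc_E hF α (by omega)
    | exact sc_sE hF α _ (by omega)

lemma psi10_sc (hF : Frame n E cf) (hn : 16 ≤ n) (α : L) (i j : ℕ) :
    SS n E cf α (psi10 L n E i j) = α ^ (i + j + (n - 10)) • psi10 L n E i j := by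
  unfold psi10
  repeat' refine ite_sc (fun h => ?_) (fun _ => ?_)
  all_goals first
    | exact sc_0
    | exact sc_E hF α (by omega)
    | exact sc_sE hF α _ (by omega)

lemma psi11_sc (hF : Frame n E cf) (hn : 16 ≤ n) (α : L) (i j : ℕ) :
    SS n E cf α (psi11 L n E i j) = α ^ (i + j + (n - 11)) • psi11 L n E i j := by
  unfold psi11
  repeat' refine ite_sc (fun h => ?_) (fun _ => ?_)
  all_goals first
    | exact sc_0
    | exact sc_E hF α (by omega)
    | exact sc_sE hF α _ (by omega)

/-- scaled parameters -/
def xs (n : ℕ) (α : L) (x : Fin 5 → L) : Fin 5 → L :=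
  ![α ^ (n - 11) * x 0, α ^ (n - 10) * x 1, α ^ (n - 9) * x 2, α ^ (n - 8) * x 3,
    α ^ (n - 7) * x 4]

lemma defTerm_sc (hF : Frame n E cf) (hn : 16 ≤ n) (α : L) (x : Fin 5 → L) (i j : ℕ) :
    SS n E cf α (defTerm L n E x i j) = α ^ (i + j) • defTerm L n E (xs n α x) i j := by
  have e0 : xs n α x 0 = α ^ (n - 11) * x 0 := rfl
  have e1 : xs n α x 1 = α ^ (n - 10) * x 1 := rfl
  have e2 : xs n α x 2 = α ^ (n - 9) * x 2 := rfl
  have e3 : xs n α x 3 = α ^ (n - 8) * x 3 := rfl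
  have e4 : xs n α x 4 = α ^ (n - 7) * x 4 := rfl
  unfold defTerm
  rw [e0, e1, e2, e3, e4]
  simp only [map_add, map_smul, psi7_sc hF hn, psi8_sc hF hn, psi9_sc hF hn, psi10_sc hF hn,
    psi11_sc hF hn, pow_add]
  module

/-- conjugated bracket -/
def Bc (n : ℕ) (E : ℕ → M) (cf : ℕ → M →ₗ[L] L) (α : L) (B : M →ₗ[L] M →ₗ[L] M) :
    M →ₗ[L] M →ₗ[L] M :=
  (B.compl₁₂ (SS n E cf α⁻¹) (SS n E cf α⁻¹)).compr₂ (SS n E cf α)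

lemma Bc_apply (α : L) (B : M →ₗ[L] M →ₗ[L] M) (a b : M) :
    Bc n E cf α B a b = SS n E cf α (B (SS n E cf α⁻¹ a) (SS n E cf α⁻¹ b)) := rfl

lemma Bc_def (hF : Frame n E cf) {B : M →ₗ[L] M →ₗ[L] M} (hn : 16 ≤ n) {α : L} (h0 : α ≠ 0)
    (x : Fin 5 → L)
    (hB : ∀ i j : ℕ, 1 ≤ i → i < j → j ≤ n →
      B (E i) (E j) = ((j : L) - (i : L)) • E (i + j) + defTerm L n E x i j) :
    ∀ i j : ℕ, 1 ≤ i → i < j → j ≤ n →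
      Bc n E cf α B (E i) (E j) =
        ((j : L) - (i : L)) • E (i + j) + defTerm L n E (xs n α x) i j := by
  intro i j hi hij hj
  rw [Bc_apply, SS_E hF, SS_E hF]
  simp only [map_smul, LinearMap.smul_apply, hB i j hi hij hj, map_add, SS_E hF,
    defTerm_sc hF hn]
  have h1 : (α⁻¹) ^ i * α ^ i = 1 := by rw [← mul_pow, inv_mul_cancel₀ h0, one_pow]
  have h2 : (α⁻¹) ^ j * α ^ j = 1 := by rw [← mul_pow, inv_mul_cancel₀ h0, one_pow]
  have h3 : (α⁻¹) ^ j * (α⁻¹) ^ i * α ^ (i + j) = 1 := by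
    rw [pow_add]
    linear_combination h1 * ((α⁻¹) ^ j * α ^ j) + h2
  have e : ∀ (r : L) (u v : M), (α⁻¹) ^ j • (α⁻¹) ^ i • (r • α ^ (i + j) • u + α ^ (i + j) • v) =
      ((α⁻¹) ^ j * (α⁻¹) ^ i * α ^ (i + j)) • (r • u + v) := by
    intro r u v
    module
  first
  | rw [e, h3, one_smul]
  | rw [smul_comm, e, h3, one_smul]

lemma main_back (hF : Frame n E cf) (hn : 16 ≤ n) {x y : Fin 5 → L}
    {Bx By : M →ₗ[L] M →ₗ[L] M} (altx : ∀ u, Bx u u = 0) (alty : ∀ u, By u u = 0)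
    (hBx : ∀ i j : ℕ, 1 ≤ i → i < j → j ≤ n →
      Bx (E i) (E j) = ((j : L) - (i : L)) • E (i + j) + defTerm L n E x i j)
    (hBy : ∀ i j : ℕ, 1 ≤ i → i < j → j ≤ n →
      By (E i) (E j) = ((j : L) - (i : L)) • E (i + j) + defTerm L n E y i j)
    {α : L} (h0 : α ≠ 0) (hy : y = xs n α x) :
    ∃ φ : M ≃ₗ[L] M, ∀ a b, φ (Bx a b) = By (φ a) (φ b) := by
  have h1 : α⁻¹ * α = 1 := inv_mul_cancel₀ h0
  have h2 : α * α⁻¹ = 1 := mul_inv_cancel₀ h0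
  refine ⟨LinearEquiv.ofLinear (SS n E cf α) (SS n E cf α⁻¹)
    (LinearMap.ext fun v => SS_inv hF h2 v) (LinearMap.ext fun v => SS_inv hF h1 v), ?_⟩
  have : Bc n E cf α Bx = By := by
    refine bil_ext hF (fun u => ?_) alty fun i j hi hij hj => ?_
    · rw [Bc_apply, altx, map_zero]
    · rw [Bc_def hF hn h0 x hBx i j hi hij hj, hBy i j hi hij hj, hy]
  intro a b
  rw [← this]
  simp only [LinearEquiv.ofLinear_apply, Bc_apply, SS_inv hF h1]

lemma main_forw [CharZero L] (hF : Frame n E cf) (hn : 16 ≤ n) {x y : Fin 5 → L}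
    {Bx By : M →ₗ[L] M →ₗ[L] M} (altx : ∀ u, Bx u u = 0) (alty : ∀ u, By u u = 0)
    (hBx : ∀ i j : ℕ, 1 ≤ i → i < j → j ≤ n →
      Bx (E i) (E j) = ((j : L) - (i : L)) • E (i + j) + defTerm L n E x i j)
    (hBy : ∀ i j : ℕ, 1 ≤ i → i < j → j ≤ n →
      By (E i) (E j) = ((j : L) - (i : L)) • E (i + j) + defTerm L n E y i j)
    (φ : M ≃ₗ[L] M) (hφ : ∀ a b, φ (Bx a b) = By (φ a) (φ b)) :
    ∃ α : L, α ≠ 0 ∧ xs n α x = y := by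
  have hGx := good_of hF hn altx hBx (fun i j m => defTerm_mem hF x) (defTerm_one x) (defTerm_23 x)
  have hGy := good_of hF hn alty hBy (fun i j m => defTerm_mem hF y) (defTerm_one y) (defTerm_23 y)
  obtain ⟨α, h0, hα⟩ := leading hF hn hGx hGy φ hφ
  refine ⟨α, h0, ?_⟩
  have h1 : α⁻¹ * α = 1 := inv_mul_cancel₀ h0
  refine core hF hn (Bx := Bc n E cf α Bx) (φ := φ.toLinearMap ∘ₗ SS n E cf α⁻¹) ?_ alty
    (Bc_def hF hn h0 x hBx) hBy ?_ ?_
  · intro u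
    rw [Bc_apply, altx, map_zero]
  · intro a b
    simp only [LinearMap.comp_apply, Bc_apply, SS_inv hF h1, LinearEquiv.coe_coe, hφ]
  · intro j hj
    have := Submodule.smul_mem _ ((α⁻¹) ^ j) (hα j hj)
    rw [smul_sub, smul_smul, ← mul_pow, h1, one_pow, one_smul] at this
    simpa only [LinearMap.comp_apply, SS_E hF, LinearEquiv.coe_coe, map_smul] using this

end Helpers

/-- let `K` be a field of characteristic zero and `n ≥ 16`. For
`x, y ∈ K^5`, the Lie algebras `g_x` and `g_y` (the `ℤ_{>0}`-filtered deformations of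
`V_n` with brackets `[·,·]_x` and `[·,·]_y`) are isomorphic if and only if there is
`α ∈ K`, `α ≠ 0`, with `y_1 = α^{n-11} x_1`, `y_2 = α^{n-10} x_2`, `y_3 = α^{n-9} x_3`,
`y_4 = α^{n-8} x_4`, `y_5 = α^{n-7} x_5`. -/
theorem statement1 {K : Type*} [Field K] [CharZero K] (n : ℕ) (hn : 16 ≤ n)
    {g : Type*} [LieRing g] [LieAlgebra K g] (E : ℕ → g) (hV : IsVnBasis K n E)
    (x y : Fin 5 → K) (Bx By : g →ₗ[K] g →ₗ[K] g)
    (hBx : IsDeformedBracket K n E x Bx)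
    (hBy : IsDeformedBracket K n E y By) :
    (∃ φ : g ≃ₗ[K] g, ∀ a b : g, φ (Bx a b) = By (φ a) (φ b)) ↔
    (∃ α : K, α ≠ 0 ∧
      y 0 = α ^ (n - 11) * x 0 ∧
      y 1 = α ^ (n - 10) * x 1 ∧
      y 2 = α ^ (n - 9) * x 2 ∧
      y 3 = α ^ (n - 8) * x 3 ∧
      y 4 = α ^ (n - 7) * x 4) := by
  obtain ⟨⟨b, hb⟩, h0, _⟩ := hV
  obtain ⟨cf, hF⟩ := frame_of_basis b hb h0
  obtain ⟨altx, hx⟩ := hBx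
  obtain ⟨alty, hy⟩ := hBy
  constructor
  · rintro ⟨φ, hφ⟩
    obtain ⟨α, ha, hxy⟩ := main_forw hF hn altx alty hx hy φ hφ
    refine ⟨α, ha, ?_⟩
    rw [← hxy]
    exact ⟨rfl, rfl, rfl, rfl, rfl⟩
  · rintro ⟨α, ha, e0, e1, e2, e3, e4⟩
    refine main_back hF hn altx alty hx hy ha ?_
    funext i
    fin_cases i
    · exact e0
    · exact e1
    · exact e2
    · exact e3
    · exact e4

end Paper
end

section
/- Let K be a field of characteristic zero and n ≥ 12. The quotient of the K-vector space of derivations of the Lie algebra V_n by the subspace of inner derivations (those of the form ad(x) : y ↦ [x,y] for x ∈ V_n) has dimension 4. -/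
namespace Paper

open Module Submodule

variable (K : Type*) [Field K] {g : Type*} [LieRing g] [LieAlgebra K g]

/-- The space of derivations of a Lie algebra, as a submodule of `g →ₗ[K] g`. -/
def derivationsSubmodule : Submodule K (g →ₗ[K] g) where
  carrier := {D | ∀ x y : g, D ⁅x, y⁆ = ⁅D x, y⁆ + ⁅x, D y⁆}
  add_mem' := by
    intro a b ha hb x y
    simp only [LinearMap.add_apply, ha x y, hb x y, add_lie, lie_add]
    abel
  zero_mem' := by
    intro x y
    simp
  smul_mem' := by
    intro c D hD x y
    simp only [LinearMap.smul_apply, hD x y, smul_add, smul_lie, lie_smul]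

/-- The space of inner derivations `ad(x) : y ↦ ⁅x, y⁆`, as a submodule of `g →ₗ[K] g`. -/
def innerDerivationsSubmodule : Submodule K (g →ₗ[K] g) where
  carrier := {D | ∃ x : g, ∀ y : g, D y = ⁅x, y⁆}
  add_mem' := by
    rintro a b ⟨xa, ha⟩ ⟨xb, hb⟩
    exact ⟨xa + xb, fun y => by simp [ha y, hb y, add_lie]⟩
  zero_mem' := ⟨0, fun y => by simp⟩
  smul_mem' := by
    rintro c D ⟨x, hx⟩
    exact ⟨c • x, fun y => by simp [hx y, smul_lie]⟩


lemma aux_setup {K : Type*} [Field K] {g : Type*} [LieRing g] [LieAlgebra K g]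
    (n : ℕ) (E : ℕ → g) (hV : IsVnBasis K n E) :
    ∃ c : ℕ → g →ₗ[K] K,
      (∀ m k, 1 ≤ m → m ≤ n → c m (E k) = if k = m then 1 else 0) ∧
      (∀ x y, (∀ m, 1 ≤ m → m ≤ n → c m x = c m y) → x = y) ∧
      (∀ p : g → Prop, (∀ i, 1 ≤ i → p (E i)) → p 0 → (∀ x y, p x → p y → p (x + y)) →
        (∀ (a : K) x, p x → p (a • x)) → ∀ x, p x) ∧
      (∀ F : ℕ → g, (∀ i, n < i → F i = 0) → ∃ D : g →ₗ[K] g, ∀ i, 1 ≤ i → D (E i) = F i) := by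
  obtain ⟨⟨b, hb⟩, h0, -⟩ := hV
  have hE : ∀ k (h1 : 1 ≤ k) (h2 : k ≤ n), E k = b ⟨k - 1, by omega⟩ := by
    intro k h1 h2
    rw [← hb]
    congr 1
    simp only
    omega
  refine ⟨fun m => if h : 1 ≤ m ∧ m ≤ n then b.coord ⟨m - 1, by omega⟩ else 0, ?_, ?_, ?_, ?_⟩
  · intro m k h1 h2
    simp only [h1, h2, and_self, dite_true]
    by_cases hk : 1 ≤ k ∧ k ≤ n
    · rw [hE k hk.1 hk.2, Basis.coord_apply, Basis.repr_self, Finsupp.single_apply]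
      congr 1
      simp only [Fin.mk.injEq, eq_iff_iff]
      omega
    · rw [h0 k (by omega), map_zero, if_neg (by omega)]
  · intro x y h
    apply b.repr.injective
    ext i
    have := h (i + 1) (by omega) (by omega)
    have hi : 1 ≤ (i : ℕ) + 1 ∧ (i : ℕ) + 1 ≤ n := by omega
    simp only [hi, and_self, dite_true] at this
    simpa using this
  · intro p hp hz ha hs x
    have hx : x ∈ span K (Set.range b) := by rw [b.span_eq]; trivial
    induction hx using Submodule.span_induction with
    | mem x hx => obtain ⟨i, rfl⟩ := hx; rw [← hb]; exact hp _ (by omega)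
    | zero => exact hz
    | add x y _ _ h1 h2 => exact ha x y h1 h2
    | smul a x _ h => exact hs a x h
  · intro F hF
    refine ⟨b.constr K (fun i => F (i + 1)), ?_⟩
    intro i hi
    by_cases h : i ≤ n
    · rw [hE i hi h, Basis.constr_basis]
      congr 1
      simp only
      omega
    · rw [h0 i (by omega), map_zero, hF i (by omega)]

lemma aux_bracket {K : Type*} [Field K] {g : Type*} [LieRing g] [LieAlgebra K g]
    (n : ℕ) (E : ℕ → g) (hV : IsVnBasis K n E) (i j : ℕ) (hi : 1 ≤ i) (hj : 1 ≤ j) :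
    ⁅E i, E j⁆ = ((j : K) - (i : K)) • E (i + j) := by
  obtain ⟨-, h0, h⟩ := hV
  rcases lt_trichotomy i j with hij | hij | hij
  · by_cases hjn : j ≤ n
    · exact h i j hi hij hjn
    · rw [h0 j (by omega), h0 (i + j) (by omega)]; simp
  · subst hij; simp
  · by_cases hjn : i ≤ n
    · rw [← lie_skew, h j i hj hij hjn, add_comm j i, ← neg_smul]; congr 1; ring
    · rw [h0 i (by omega), h0 (i + j) (by omega)]; simp

lemma aux_exists_der {K : Type*} [Field K] {g : Type*} [LieRing g] [LieAlgebra K g]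
    (n : ℕ) (E : ℕ → g) (hV : IsVnBasis K n E) (d : ℕ) (w : ℕ → K)
    (hw : ∀ i j : ℕ, 1 ≤ i → 1 ≤ j → i + j + d ≤ n →
      ((j : K) - i) * w (i + j) = w i * ((j : K) - (i + d)) + w j * ((j : K) + d - i)) :
    ∃ D ∈ derivationsSubmodule K (g := g), ∀ i, 1 ≤ i → D (E i) = w i • E (i + d) := by
  obtain ⟨c, -, -, hind, hF⟩ := aux_setup n E hV
  have hB := aux_bracket n E hV
  have h0 := hV.2.1
  obtain ⟨D, hD⟩ := hF (fun i => w i • E (i + d)) (by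
    intro i hi; rw [h0 _ (by omega), smul_zero])
  refine ⟨D, ?_, hD⟩
  intro x y
  refine hind (fun x => D ⁅x, y⁆ = ⁅D x, y⁆ + ⁅x, D y⁆) ?_ (by simp) ?_ ?_ x
  · intro i hi
    refine hind (fun y => D ⁅E i, y⁆ = ⁅D (E i), y⁆ + ⁅E i, D y⁆) ?_ (by simp) ?_ ?_ y
    · intro j hj
      rw [hB i j hi hj, map_smul, hD i hi, hD j hj, hD (i + j) (by omega), smul_lie, lie_smul,
        hB _ _ (by omega) hj, hB _ _ hi (by omega), show i + d + j = i + j + d by ring,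
        show i + (j + d) = i + j + d by ring, smul_smul, smul_smul, smul_smul, ← add_smul]
      by_cases h : i + j + d ≤ n
      · congr 1
        push_cast
        exact hw i j hi hj h
      · rw [h0 _ (by omega)]; simp
    · intro x y hx hy
      simp only [lie_add, map_add, hx, hy]; abel
    · intro a x hx
      simp only [lie_smul, map_smul, hx, smul_add]
  · intro x y hx hy
    simp only [add_lie, map_add, hx, hy]; abel
  · intro a x hx
    simp only [smul_lie, map_smul, hx, smul_add]

lemma aux_coord {K : Type*} [Field K] {g : Type*} [LieRing g] [LieAlgebra K g]
    (n : ℕ) (E : ℕ → g) (hV : IsVnBasis K n E) (c : ℕ → g →ₗ[K] K)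
    (hc : ∀ m k, 1 ≤ m → m ≤ n → c m (E k) = if k = m then 1 else 0)
    (k j : ℕ) (hk : 1 ≤ k) (hj : 1 ≤ j) (hkj : k + j ≤ n) (u : g) :
    c (k + j) ⁅u, E j⁆ = ((j : K) - k) * c k u := by
  obtain ⟨-, -, -, hind, -⟩ := aux_setup n E hV
  have hB := aux_bracket n E hV
  refine hind (fun u => c (k + j) ⁅u, E j⁆ = ((j : K) - k) * c k u) ?_ (by simp) ?_ ?_ u
  · intro i hi
    rw [hB i j hi hj, map_smul, hc _ _ (by omega) hkj, hc _ _ hk (by omega)]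
    by_cases h : i = k
    · subst h; simp
    · rw [if_neg (by omega), if_neg h]; simp
  · intro x y hx hy
    simp only [add_lie, map_add, hx, hy]; ring
  · intro a x hx
    simp only [smul_lie, map_smul, hx, smul_eq_mul]; ring

lemma aux_coord_low {K : Type*} [Field K] {g : Type*} [LieRing g] [LieAlgebra K g]
    (n : ℕ) (E : ℕ → g) (hV : IsVnBasis K n E) (c : ℕ → g →ₗ[K] K)
    (hc : ∀ m k, 1 ≤ m → m ≤ n → c m (E k) = if k = m then 1 else 0)
    (m j : ℕ) (hm : 1 ≤ m) (hj : 1 ≤ j) (hmj : m ≤ j) (hmn : m ≤ n) (u : g) :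
    c m ⁅u, E j⁆ = 0 := by
  obtain ⟨-, -, -, hind, -⟩ := aux_setup n E hV
  have hB := aux_bracket n E hV
  refine hind (fun u => c m ⁅u, E j⁆ = 0) ?_ (by simp) ?_ ?_ u
  · intro i hi
    rw [hB i j hi hj, map_smul, hc _ _ (by omega) hmn, if_neg (by omega), smul_zero]
  · intro x y hx hy
    simp only [add_lie, map_add, hx, hy]; ring
  · intro a x hx
    simp only [smul_lie, map_smul, hx, smul_zero]

lemma aux_rel {K : Type*} [Field K] {g : Type*} [LieRing g] [LieAlgebra K g]
    (n : ℕ) (E : ℕ → g) (hV : IsVnBasis K n E) (c : ℕ → g →ₗ[K] K)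
    (hc : ∀ m k, 1 ≤ m → m ≤ n → c m (E k) = if k = m then 1 else 0)
    (i : ℕ) (hi : 1 ≤ i) (hin : i + 3 ≤ n) (Y : g) :
    c (i + 3) (⁅E 1, ⁅E 1, ⁅E 1, Y⁆⁆⁆ - (6 : K) • (⁅Y, E 3⁆ + ⁅E 2, ⁅E 1, Y⁆⁆)) =
      (((i : K) - 1) * i * (i + 1) - 6 * ((3 - i) + (i - 1) ^ 2)) * c i Y := by
  obtain ⟨-, -, -, hind, -⟩ := aux_setup n E hV
  have hB := aux_bracket n E hV
  refine hind (fun Y => c (i + 3) (⁅E 1, ⁅E 1, ⁅E 1, Y⁆⁆⁆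
      - (6 : K) • (⁅Y, E 3⁆ + ⁅E 2, ⁅E 1, Y⁆⁆)) =
      (((i : K) - 1) * i * (i + 1) - 6 * ((3 - i) + (i - 1) ^ 2)) * c i Y) ?_ (by simp) ?_ ?_ Y
  · intro k hk
    rw [hB 1 k le_rfl hk, lie_smul, lie_smul, lie_smul, hB 1 _ le_rfl (by omega), lie_smul,
      hB 1 _ le_rfl (by omega), hB k 3 hk (by omega), hB 2 _ (by omega) (by omega),
      show 1 + (1 + (1 + k)) = k + 3 by ring, show 2 + (1 + k) = k + 3 by ring]
    simp only [map_sub, map_add, map_smul, smul_eq_mul]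
    rw [hc _ _ (by omega) hin, hc _ _ hi (by omega)]
    by_cases h : k = i
    · subst h; push_cast; simp; ring
    · rw [if_neg (by omega), if_neg h]; simp
  · intro x y hx hy
    rw [map_add, mul_add, ← hx, ← hy, ← map_add]
    congr 1
    simp only [add_lie, lie_add, smul_add]
    abel
  · intro a x hx
    rw [map_smul, smul_eq_mul, mul_left_comm, ← hx, ← smul_eq_mul, ← map_smul]
    congr 1
    simp only [smul_lie, lie_smul, smul_add, smul_sub, smul_comm a (6 : K)]

lemma aux_gen {K : Type*} [Field K] [CharZero K] {g : Type*} [LieRing g] [LieAlgebra K g]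
    (n : ℕ) (E : ℕ → g) (hV : IsVnBasis K n E) (D : g →ₗ[K] g)
    (hD : D ∈ derivationsSubmodule K (g := g)) (h1 : D (E 1) = 0) (h2 : D (E 2) = 0) :
    ∀ x, D x = 0 := by
  obtain ⟨-, -, -, hind, -⟩ := aux_setup n E hV
  have hB := aux_bracket n E hV
  have key : ∀ i, D (E (i + 1)) = 0 := by
    intro i
    induction i with
    | zero => exact h1
    | succ i ih =>
      rcases i with _ | i
      · exact h2
      · have h := hD (E 1) (E (i + 1 + 1))
        rw [h1, ih, hB _ _ le_rfl (by omega), map_smul, zero_lie, lie_zero, add_zero] at h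
        rcases smul_eq_zero.1 h with h | h
        · exfalso
          push_cast at h
          have : ((i + 1 : ℕ) : K) = 0 := by push_cast; linear_combination h
          exact absurd this (Nat.cast_ne_zero.2 (by omega))
        · rw [← h]; congr 2; ring
  refine hind (fun x => D x = 0) ?_ (by simp) ?_ ?_
  · intro i hi
    obtain ⟨k, rfl⟩ : ∃ k, i = k + 1 := ⟨i - 1, by omega⟩
    exact key k
  · intro x y hx hy
    simp only [map_add, hx, hy, add_zero]
  · intro a x hx
    simp only [map_smul, hx, smul_zero]

lemma aux_zero {K : Type*} [Field K] [CharZero K] {g : Type*} [LieRing g] [LieAlgebra K g]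
    (n : ℕ) (hn : 12 ≤ n) (E : ℕ → g) (hV : IsVnBasis K n E) (c : ℕ → g →ₗ[K] K)
    (hc : ∀ m k, 1 ≤ m → m ≤ n → c m (E k) = if k = m then 1 else 0)
    (hext : ∀ x y, (∀ m, 1 ≤ m → m ≤ n → c m x = c m y) → x = y)
    (D : g →ₗ[K] g) (hD : D ∈ derivationsSubmodule K (g := g)) (a : K)
    (h1 : D (E 1) = a • E 2) (h3 : c 3 (D (E 2)) = 0)
    (hh : ∀ m, n < m + 3 → m ≤ n → c m (D (E 2)) = 0) :
    ∀ x, D x = 0 := by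
  have hB := aux_bracket n E hV
  have hrel := aux_rel n E hV c hc
  obtain ⟨Y, hY⟩ : ∃ Y, Y = D (E 2) := ⟨_, rfl⟩
  have e3 : E 3 = ⁅E 1, E 2⁆ := by rw [hB 1 2 (by omega) (by omega)]; norm_num
  have e4 : (2 : K) • E 4 = ⁅E 1, E 3⁆ := by rw [hB 1 3 (by omega) (by omega)]; norm_num
  have e5 : (3 : K) • E 5 = ⁅E 1, E 4⁆ := by rw [hB 1 4 (by omega) (by omega)]; norm_num
  have e5' : E 5 = ⁅E 2, E 3⁆ := by rw [hB 2 3 (by omega) (by omega)]; norm_num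
  have b24 : ⁅E 2, E 4⁆ = (2 : K) • E 6 := by rw [hB 2 4 (by omega) (by omega)]; norm_num
  have b15 : ⁅E 1, E 5⁆ = (4 : K) • E 6 := by rw [hB 1 5 (by omega) (by omega)]; norm_num
  have d3 : D (E 3) = ⁅E 1, Y⁆ := by
    rw [e3, hD, h1, ← hY]; simp
  have d4 : (2 : K) • D (E 4) = a • E 5 + ⁅E 1, ⁅E 1, Y⁆⁆ := by
    rw [← map_smul, e4, hD, h1, d3, smul_lie, ← e5']
  have d5 : (6 : K) • D (E 5) = (8 * a) • E 6 + ⁅E 1, ⁅E 1, ⁅E 1, Y⁆⁆⁆ := by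
    have : (6 : K) • D (E 5) = (2 : K) • D ((3 : K) • E 5) := by
      rw [map_smul, smul_smul]; norm_num
    rw [this, e5, hD, h1, smul_add, ← lie_smul (2 : K) (E 1), d4, smul_lie, b24, lie_add, lie_smul,
      b15, ← add_assoc]
    congr 1
    module
  have d5' : D (E 5) = ⁅Y, E 3⁆ + ⁅E 2, ⁅E 1, Y⁆⁆ := by
    rw [e5', hD, d3, ← hY]
  have main : ⁅E 1, ⁅E 1, ⁅E 1, Y⁆⁆⁆ - (6 : K) • (⁅Y, E 3⁆ + ⁅E 2, ⁅E 1, Y⁆⁆)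
      = (-(8 * a)) • E 6 := by
    rw [← d5', d5]; module
  have ha : a = 0 := by
    have := aux_rel n E hV c hc 3 (by omega) (by omega) Y
    rw [main, hY, h3, map_smul, hc _ _ (by omega) (by omega)] at this
    simpa using this
  have hY0 : Y = 0 := by
    apply hext
    intro m hm hmn
    rw [map_zero]
    by_cases h : m + 3 ≤ n
    · by_cases hm3 : m = 3
      · rw [hm3, hY, h3]
      have := aux_rel n E hV c hc m hm h Y
      rw [main, ha] at this
      simp only [mul_zero, neg_zero, zero_smul, map_zero] at this
      rcases mul_eq_zero.1 this.symm with h' | h'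
      · exfalso
        have h2 : ((m : K) - 3) * ((m : K) ^ 2 - 3 * m + 8) = 0 := by linear_combination h'
        rcases mul_eq_zero.1 h2 with h4 | h4
        · apply hm3
          have : (m : K) = (3 : ℕ) := by push_cast; linear_combination h4
          exact_mod_cast this
        · have : (((m : ℤ) ^ 2 - 3 * m + 8 : ℤ) : K) = 0 := by push_cast; exact h4
          have : (m : ℤ) ^ 2 - 3 * m + 8 = 0 := by exact_mod_cast this
          nlinarith [sq_nonneg (2 * (m : ℤ) - 3)]
      · exact h'
    · rw [hY]; exact hh m (by omega) hmn
  exact aux_gen n E hV D hD (by rw [h1, ha, zero_smul]) (by rw [← hY, hY0])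

lemma aux_inner {K : Type*} [Field K] [CharZero K] {g : Type*} [LieRing g] [LieAlgebra K g]
    (n : ℕ) (hn : 12 ≤ n) (E : ℕ → g) (hV : IsVnBasis K n E) (c : ℕ → g →ₗ[K] K)
    (hc : ∀ m k, 1 ≤ m → m ≤ n → c m (E k) = if k = m then 1 else 0)
    (hext : ∀ x y, (∀ m, 1 ≤ m → m ≤ n → c m x = c m y) → x = y)
    (D : g →ₗ[K] g) (hD : D ∈ derivationsSubmodule K (g := g))
    (h1 : c 1 (D (E 1)) = 0)
    (hh : ∀ d, n ≤ d + 4 → d + 2 ≤ n →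
      (1 - (d : K)) * c (d + 2) (D (E 2)) = (2 - (d : K)) * c (d + 1) (D (E 1))) :
    ∃ u : g, ∀ x, D x = ⁅u, x⁆ := by
  have hlow := aux_coord_low n E hV c hc
  have hco := aux_coord n E hV c hc
  obtain ⟨f, hf⟩ : ∃ f : ℕ → K, f = fun d => if d = 1 then c 3 (D (E 2)) else
    c (d + 1) (D (E 1)) / (1 - (d : K)) := ⟨_, rfl⟩
  obtain ⟨u, hu⟩ : ∃ u : g, ∀ m, 1 ≤ m → m ≤ n → c m u = f m := by
    refine ⟨∑ i ∈ Finset.Icc 1 n, f i • E i, ?_⟩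
    intro m h1 h2
    rw [map_sum, Finset.sum_eq_single m]
    · rw [map_smul, hc _ _ h1 h2]; simp
    · intro k _ hk
      rw [map_smul, hc _ _ h1 h2, if_neg hk, smul_zero]
    · intro h; exact absurd (Finset.mem_Icc.2 ⟨h1, h2⟩) h
  have hne : ∀ d : ℕ, 2 ≤ d → (1 - (d : K)) ≠ 0 := by
    intro d hd h
    have : (d : K) = (1 : ℕ) := by push_cast; linear_combination -h
    have : d = 1 := by exact_mod_cast this
    omega
  have hfd : ∀ d : ℕ, 2 ≤ d → (1 - (d : K)) * f d = c (d + 1) (D (E 1)) := by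
    intro d hd
    rw [hf]
    simp only
    rw [if_neg (by omega), mul_div_cancel₀ _ (hne d hd)]
  obtain ⟨D', hD'⟩ : ∃ D' : g →ₗ[K] g, ∀ x, D' x = D x - ⁅u, x⁆ :=
    ⟨D - (LieAlgebra.ad K g u : g →ₗ[K] g), fun x => by simp⟩
  have hDer : D' ∈ derivationsSubmodule K (g := g) := by
    intro x y
    rw [hD', hD', hD', hD x y, sub_lie, lie_sub, leibniz_lie u x y]
    abel
  have hz := aux_zero n hn E hV c hc hext D' hDer (c 2 (D (E 1))) ?_ ?_ ?_
  · refine ⟨u, fun x => ?_⟩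
    have := hz x
    rw [hD'] at this
    exact sub_eq_zero.1 this
  · apply hext
    intro m hm hmn
    rw [hD', map_sub, map_smul, hc _ _ hm hmn]
    rcases Nat.lt_or_ge m 2 with h | h
    · obtain rfl : m = 1 := by omega
      rw [h1, hlow 1 1 le_rfl le_rfl le_rfl hmn]; simp
    · obtain ⟨k, rfl⟩ : ∃ k, m = k + 1 := ⟨m - 1, by omega⟩
      rw [hco k 1 (by omega) le_rfl hmn]
      by_cases hk : k = 1
      · subst hk; simp
      · rw [hu _ (by omega) (by omega), Nat.cast_one, hfd k (by omega), if_neg (by omega)]; simp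
  · have := hco 1 2 (by omega) (by omega) (by omega) u
    rw [hD', map_sub, this, hu _ (by omega) (by omega), hf]
    simp; ring
  · intro m hm hmn
    obtain ⟨d, rfl⟩ : ∃ d, m = d + 2 := ⟨m - 2, by omega⟩
    have h := hh d (by omega) hmn
    rw [hD', map_sub, hco d 2 (by omega) (by omega) hmn, hu _ (by omega) (by omega)]
    apply (mul_eq_zero.1 _).resolve_left (hne d (by omega))
    rw [← hfd d (by omega)] at h
    push_cast
    linear_combination h

theorem statement4 {K : Type*} [Field K] [CharZero K]
    {g : Type*} [LieRing g] [LieAlgebra K g]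
    (n : ℕ) (hn : 12 ≤ n) (E : ℕ → g) (hV : IsVnBasis K n E) :
    Module.finrank K
      (derivationsSubmodule K (g := g) ⧸
        ((innerDerivationsSubmodule K (g := g)).comap
          (derivationsSubmodule K (g := g)).subtype)) = 4 := by
  obtain ⟨c, hc, hext, -, -⟩ := aux_setup n E hV
  have hlow := aux_coord_low n E hV c hc
  have hco := aux_coord n E hV c hc
  obtain ⟨q, rfl⟩ : ∃ q, n = q + 4 := ⟨n - 4, by omega⟩
  let ψ : ℕ → (g →ₗ[K] g) →ₗ[K] K := fun d =>
    (1 - (d : K)) • (c (d + 2) ∘ₗ LinearMap.applyₗ (E 2)) -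
      (2 - (d : K)) • (c (d + 1) ∘ₗ LinearMap.applyₗ (E 1))
  have hψ : ∀ d D, ψ d D = (1 - (d : K)) * c (d + 2) (D (E 2))
      - (2 - (d : K)) * c (d + 1) (D (E 1)) := by
    intro d D; simp [ψ]
  let Φ : derivationsSubmodule K (g := g) →ₗ[K] (Fin 4 → K) :=
    (LinearMap.pi ![c 1 ∘ₗ LinearMap.applyₗ (E 1), ψ q, ψ (q + 1), ψ (q + 2)]) ∘ₗ
      (derivationsSubmodule K (g := g)).subtype
  have hΦ : ∀ D, Φ D = ![c 1 (D.1 (E 1)), ψ q D.1, ψ (q + 1) D.1, ψ (q + 2) D.1] := by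
    intro D; funext i; fin_cases i <;> simp [Φ]
  have hker : (innerDerivationsSubmodule K (g := g)).comap
      (derivationsSubmodule K (g := g)).subtype = LinearMap.ker Φ := by
    ext D
    rw [LinearMap.mem_ker, Submodule.mem_comap, hΦ]
    constructor
    · rintro ⟨u, hu⟩
      simp only [Submodule.subtype_apply] at hu
      have hz : ∀ d, 1 ≤ d → d + 2 ≤ q + 4 → ψ d D.1 = 0 := by
        intro d h1 h2
        rw [hψ, hu, hu, hco d 2 h1 (by omega) h2, hco d 1 h1 le_rfl (by omega)]
        push_cast; ring
      rw [hz q (by omega) (by omega), hz (q + 1) (by omega) (by omega),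
        hz (q + 2) (by omega) (by omega), hu, hlow 1 1 le_rfl le_rfl le_rfl (by omega)]
      funext i; fin_cases i <;> rfl
    · intro h
      have h0 := congrFun h 0
      have h1 := congrFun h 1
      have h2 := congrFun h 2
      have h3 := congrFun h 3
      simp only [Matrix.cons_val, Pi.zero_apply] at h0 h1 h2 h3
      refine aux_inner (q + 4) hn E hV c hc hext D.1 D.2 h0 ?_
      intro d hd1 hd2
      rw [← sub_eq_zero, ← hψ]
      obtain rfl | rfl | rfl : d = q ∨ d = q + 1 ∨ d = q + 2 := by omega
      · exact h1
      · exact h2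
      · exact h3
  have hsurj : Function.Surjective Φ := by
    obtain ⟨D0, hD0, hE0⟩ := aux_exists_der (q + 4) E hV 0 (fun i => (i : K)) (by
      intro i j _ _ _; push_cast; ring)
    have hex : ∀ d, q ≤ d → ∃ D ∈ derivationsSubmodule K (g := g), D (E 1) = 0 ∧
        D (E 2) = E (2 + d) := by
      intro d hd
      obtain ⟨D, hD, hE⟩ := aux_exists_der (q + 4) E hV d
        (fun i => if i = 2 then 1 else if i = 3 then (d : K) + 1 else
          if i = 4 then ((d : K) + 1) * (d + 2) / 2 else 0) (by
        intro i j hi hj hij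
        have h : (i = 1 ∧ j = 1) ∨ (i = 1 ∧ j = 2) ∨ (i = 1 ∧ j = 3) ∨ (i = 2 ∧ j = 1) ∨
          (i = 2 ∧ j = 2) ∨ (i = 3 ∧ j = 1) := by omega
        rcases h with ⟨rfl, rfl⟩ | ⟨rfl, rfl⟩ | ⟨rfl, rfl⟩ | ⟨rfl, rfl⟩ | ⟨rfl, rfl⟩ | ⟨rfl, rfl⟩ <;>
        norm_num <;> ring)
      refine ⟨D, hD, ?_, ?_⟩
      · rw [hE 1 le_rfl]; simp
      · rw [hE 2 (by omega)]; simp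
    obtain ⟨A, hA, hA1, hA2⟩ := hex q le_rfl
    obtain ⟨B, hB, hB1, hB2⟩ := hex (q + 1) (by omega)
    obtain ⟨C, hC, hC1, hC2⟩ := hex (q + 2) (by omega)
    have hne : ∀ d : ℕ, 2 ≤ d → (1 - (d : K)) ≠ 0 := by
      intro d hd h
      have : (d : K) = (1 : ℕ) := by push_cast; linear_combination -h
      have : d = 1 := by exact_mod_cast this
      omega
    intro v
    refine ⟨v 0 • ⟨D0, hD0⟩ + (v 1 / (1 - (q : K))) • ⟨A, hA⟩
      + (v 2 / (1 - ((q + 1 : ℕ) : K))) • ⟨B, hB⟩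
      + (v 3 / (1 - ((q + 2 : ℕ) : K))) • ⟨C, hC⟩, ?_⟩
    have hval : ∀ (D : g →ₗ[K] g) (d e : ℕ), q ≤ e → e ≤ q + 2 → D (E 1) = 0 →
        D (E 2) = E (2 + d) → ψ e D = if d = e then 1 - (e : K) else 0 := by
      intro D d e h0 h1 h2 h3
      rw [hψ, h2, h3, hc _ _ (by omega) (by omega)]
      by_cases h : d = e
      · rw [if_pos (by omega), if_pos h]; simp
      · rw [if_neg (by omega), if_neg h]; simp
    have hval0 : ∀ e, q ≤ e → e ≤ q + 2 → ψ e D0 = 0 := by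
      intro e h0 h1
      rw [hψ, hE0 1 le_rfl, hE0 2 (by omega), map_smul, map_smul, hc _ _ (by omega) (by omega),
        hc _ _ (by omega) (by omega), if_neg (by omega), if_neg (by omega)]
      simp
    have hc0 : c 1 (D0 (E 1)) = 1 := by
      rw [hE0 1 le_rfl, map_smul, hc _ _ (by omega) (by omega)]; simp
    rw [hΦ]
    simp only [Submodule.coe_add, Submodule.coe_smul, map_add, map_smul, LinearMap.add_apply,
      LinearMap.smul_apply, hA1, hB1, hC1, hc0]
    rw [hval0 q (by omega) (by omega), hval0 (q + 1) (by omega) (by omega),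
      hval0 (q + 2) (by omega) (by omega),
      hval A q q (by omega) (by omega) hA1 hA2,
      hval A q (q + 1) (by omega) (by omega) hA1 hA2,
      hval A q (q + 2) (by omega) (by omega) hA1 hA2,
      hval B (q + 1) q (by omega) (by omega) hB1 hB2,
      hval B (q + 1) (q + 1) (by omega) (by omega) hB1 hB2,
      hval B (q + 1) (q + 2) (by omega) (by omega) hB1 hB2,
      hval C (q + 2) q (by omega) (by omega) hC1 hC2,
      hval C (q + 2) (q + 1) (by omega) (by omega) hC1 hC2,
      hval C (q + 2) (q + 2) (by omega) (by omega) hC1 hC2]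
    have n1 := hne q (by omega)
    have n2 := hne (q + 1) (by omega)
    have n3 := hne (q + 2) (by omega)
    funext i
    fin_cases i
    · simp
    · simp [div_mul_cancel₀ _ n1]
    · simpa using div_mul_cancel₀ (v 2) n2
    · simpa using div_mul_cancel₀ (v 3) n3
  rw [hker, (Φ.quotKerEquivOfSurjective hsurj).finrank_eq]
  simp

end Paper
end

section
/- Let K be a field of characteristic zero and n ≥ 12. The center of the Lie algebra V_n equals the span of the basis vector e_n; in particular the center of V_n is one-dimensional. -/
namespace Paper

open Module Submodule

variable (K : Type*) [Field K] {g : Type*} [LieRing g] [LieAlgebra K g]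

/-- The center `{x ∈ g : ⁅x,y⁆ = 0 for all y}` of a Lie algebra, as a submodule. -/
def centerSubmodule : Submodule K g where
  carrier := {x : g | ∀ y : g, ⁅x, y⁆ = 0}
  add_mem' := by
    intro a b ha hb y
    rw [add_lie, ha y, hb y, add_zero]
  zero_mem' := by
    intro y
    exact zero_lie y
  smul_mem' := by
    intro c x hx y
    rw [smul_lie, hx y, smul_zero]

theorem statement5 {K : Type*} [Field K] [CharZero K]
    {g : Type*} [LieRing g] [LieAlgebra K g]
    (n : ℕ) (hn : 12 ≤ n) (E : ℕ → g) (hV : IsVnBasis K n E) :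
    centerSubmodule K (g := g) = Submodule.span K {E n} ∧
    Module.finrank K (centerSubmodule K (g := g)) = 1 := by
  obtain ⟨⟨b, hb⟩, h0, hl⟩ := hV
  have hc : ∀ (m : ℕ) (k : Fin n), b.repr (E m) k = if m = (k : ℕ) + 1 then 1 else 0 := by
    intro m k
    by_cases hm : m = 0 ∨ n < m
    · rw [h0 m hm, if_neg (by have := k.2; omega)]
      simp
    · have h1 : E m = b ⟨m - 1, by omega⟩ := by
        rw [← hb]
        congr 1
        simp only
        omega
      rw [h1, Basis.repr_self, Finsupp.single_apply]
      congr 1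
      rw [Fin.ext_iff]
      simp only [eq_iff_iff]
      omega
  have hx : ∀ x : g, x = ∑ i : Fin n, b.repr x i • E ((i : ℕ) + 1) := by
    intro x
    simp_rw [hb]
    exact (b.sum_repr x).symm
  have hne : E n ≠ 0 := by
    intro h
    have := hc n ⟨n - 1, by omega⟩
    rw [h, if_pos (by simp only; omega)] at this
    simp at this
  have hEn : ∀ y : g, ⁅E n, y⁆ = 0 := by
    intro y
    rw [hx y, lie_sum]
    apply Finset.sum_eq_zero
    intro i _
    rw [lie_smul]
    by_cases hi : (i : ℕ) + 1 = n
    · rw [hi, lie_self, smul_zero]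
    · rw [← lie_skew, hl _ n (by omega) (by have := i.2; omega) le_rfl,
        h0 _ (Or.inr (by omega))]
      simp
  have key : centerSubmodule K (g := g) = Submodule.span K {E n} := by
    apply le_antisymm
    · intro x hxc
      have hxc' : ∀ y : g, ⁅x, y⁆ = 0 := hxc
      have hmid : ∀ k : Fin n, 1 ≤ (k : ℕ) → (k : ℕ) + 1 < n → b.repr x k = 0 := by
        intro k hk1 hk2
        have h1 : ⁅E 1, x⁆ = 0 := by rw [← lie_skew, hxc', neg_zero]
        rw [hx x, lie_sum] at h1
        have h2 : ∀ i : Fin n, ⁅E 1, b.repr x i • E ((i : ℕ) + 1)⁆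
            = (b.repr x i * ((i : ℕ) : K)) • E ((i : ℕ) + 2) := by
          intro i
          rw [lie_smul]
          by_cases hi : (i : ℕ) = 0
          · simp [hi]
          · rw [hl 1 _ le_rfl (by omega) (by have := i.2; omega), smul_smul,
              show 1 + ((i : ℕ) + 1) = (i : ℕ) + 2 by omega]
            push_cast
            simp
        simp_rw [h2] at h1
        have h3 := congrArg (fun z => b.repr z ⟨(k : ℕ) + 1, hk2⟩) h1
        simp only [map_sum, map_smul, Finsupp.coe_finset_sum, Finset.sum_apply,
          Finsupp.smul_apply, hc, map_zero, Finsupp.zero_apply] at h3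
        rw [Finset.sum_eq_single k] at h3
        · simp only [if_true, smul_eq_mul, mul_one, mul_eq_zero, Nat.cast_eq_zero] at h3
          rcases h3 with h3 | h3
          · exact h3
          · omega
        · intro i _ hik
          rw [if_neg, smul_zero]
          intro h
          exact hik (Fin.ext (by omega))
        · simp
      have hx2 : x = b.repr x ⟨0, by omega⟩ • E 1 + b.repr x ⟨n - 1, by omega⟩ • E n := by
        conv_lhs => rw [hx x]
        rw [Finset.sum_eq_add (⟨0, by omega⟩ : Fin n) (⟨n - 1, by omega⟩ : Fin n)]
        · simp only [zero_add, show n - 1 + 1 = n by omega]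
        · intro h
          rw [Fin.ext_iff] at h
          simp only at h
          omega
        · intro i _ hi
          obtain ⟨h1, h2⟩ := hi
          rw [Ne, Fin.ext_iff] at h1 h2
          simp only at h1 h2
          rw [hmid i (by omega) (by have := i.2; omega), zero_smul]
        · simp
        · simp
      have h4 := hxc' (E 2)
      rw [hx2, add_lie, smul_lie, smul_lie, hEn, smul_zero, add_zero,
        hl 1 2 le_rfl (by omega) (by omega)] at h4
      have h5 := congrArg (fun z => b.repr z ⟨2, by omega⟩) h4
      simp only [map_smul, Finsupp.smul_apply, hc, map_zero, Finsupp.zero_apply] at h5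
      norm_num at h5
      rw [hx2, h5, zero_smul, zero_add]
      exact Submodule.smul_mem _ _ (Submodule.mem_span_singleton_self _)
    · rw [Submodule.span_singleton_le_iff_mem]
      exact hEn
  refine ⟨key, ?_⟩
  rw [key]
  exact finrank_span_singleton hne

end Paper
end

section
/- Let K be a field of characteristic zero and n ≥ 12. The K-vector space of derivations D of the Lie algebra V_n satisfying D(e_i) ∈ span(e_{i+1}, …, e_n) for every 1 ≤ i ≤ n has dimension n + 2. -/
namespace Paper

open Module Submodule

variable (K : Type*) [Field K] {g : Type*} [LieRing g] [LieAlgebra K g]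

/-- The space of derivations `D` of the Lie algebra `g` (with distinguished basis `E`)
such that `D (e_i) ∈ span (e_{i+1}, …, e_n)` for all `1 ≤ i ≤ n`, as a submodule of
`g →ₗ[K] g`. -/
def triangularDerivations (n : ℕ) (E : ℕ → g) : Submodule K (g →ₗ[K] g) where
  carrier := {D | (∀ x y : g, D ⁅x, y⁆ = ⁅D x, y⁆ + ⁅x, D y⁆) ∧
    ∀ i : ℕ, 1 ≤ i → i ≤ n → D (E i) ∈ Submodule.span K (E '' Set.Icc (i + 1) n)}
  add_mem' := by
    rintro a b ⟨ha1, ha2⟩ ⟨hb1, hb2⟩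
    refine ⟨fun x y => ?_, fun i hi1 hi2 => ?_⟩
    · simp only [LinearMap.add_apply, ha1 x y, hb1 x y, add_lie, lie_add]
      abel
    · exact add_mem (ha2 i hi1 hi2) (hb2 i hi1 hi2)
  zero_mem' := ⟨fun x y => by simp, fun i _ _ => zero_mem _⟩
  smul_mem' := by
    rintro c D ⟨hD1, hD2⟩
    refine ⟨fun x y => ?_, fun i hi1 hi2 => ?_⟩
    · simp only [LinearMap.smul_apply, hD1 x y, smul_add, smul_lie, lie_smul]
    · exact Submodule.smul_mem _ c (hD2 i hi1 hi2)

namespace Aux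
set_option linter.unusedSectionVars false

variable {K : Type*} [Field K] [CharZero K] {g : Type*} [LieRing g] [LieAlgebra K g]

lemma br {n : ℕ} {E : ℕ → g} (hV : IsVnBasis K n E) (i j : ℕ) (hi : 1 ≤ i) (hj : 1 ≤ j) :
    ⁅E i, E j⁆ = ((j : K) - (i : K)) • E (i + j) := by
  obtain ⟨_, h0, h⟩ := hV
  by_cases hin : n < i
  · rw [h0 i (Or.inr hin), h0 (i + j) (Or.inr (by omega))]; simp
  by_cases hjn : n < j
  · rw [h0 j (Or.inr hjn), h0 (i + j) (Or.inr (by omega))]; simp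
  rcases lt_trichotomy i j with hij | hij | hij
  · exact h i j hi hij (by omega)
  · subst hij; simp
  · rw [← lie_skew, h j i hj hij (by omega), add_comm j i, ← neg_smul, neg_sub]

lemma ext_E {n : ℕ} {E : ℕ → g} (hV : IsVnBasis K n E) {M : Type*} [AddCommGroup M] [Module K M]
    {f f' : g →ₗ[K] M} (h : ∀ j, 1 ≤ j → j ≤ n → f (E j) = f' (E j)) : f = f' := by
  obtain ⟨⟨b, hb⟩, _, _⟩ := hV
  apply b.ext
  intro i
  rw [← hb i]
  exact h _ (by omega) (by omega)

lemma exists_map {n : ℕ} {E : ℕ → g} (hV : IsVnBasis K n E) {M : Type*} [AddCommGroup M]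
    [Module K M] (F : ℕ → M) : ∃ f : g →ₗ[K] M, ∀ j, 1 ≤ j → j ≤ n → f (E j) = F j := by
  obtain ⟨⟨b, hb⟩, _, _⟩ := hV
  refine ⟨b.constr K (fun i : Fin n => F ((i : ℕ) + 1)), fun j h1 h2 => ?_⟩
  have := hb ⟨j - 1, by omega⟩
  simp only [Nat.sub_add_cancel h1] at this
  rw [this, Basis.constr_basis]
  simp [Nat.sub_add_cancel h1]

lemma exists_coef {n : ℕ} {E : ℕ → g} (hV : IsVnBasis K n E) :
    ∃ c : ℕ → g →ₗ[K] K, (∀ m j, 1 ≤ j → j ≤ n → c m (E j) = if m = j then 1 else 0) ∧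
      (∀ x, (x = ∑ m ∈ Finset.Icc 1 n, c m x • E m)) := by
  choose c hc using fun m : ℕ => exists_map hV (fun j => if m = j then (1 : K) else 0)
  refine ⟨c, hc, ?_⟩
  have : (LinearMap.id : g →ₗ[K] g)
      = ∑ m ∈ Finset.Icc 1 n, (c m).smulRight (E m) := by
    apply ext_E hV
    intro j h1 h2
    simp only [LinearMap.id_apply, LinearMap.sum_apply, LinearMap.smulRight_apply]
    rw [Finset.sum_eq_single j]
    · simp [hc j j h1 h2]
    · intro m _ hm; simp [hc m j h1 h2, hm]
    · intro hj; simp [h1, h2] at hj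
  intro x
  have := LinearMap.congr_fun this x
  simpa using this

lemma coef_br {n : ℕ} {E : ℕ → g} (hV : IsVnBasis K n E) {c : ℕ → g →ₗ[K] K}
    (hc : ∀ m j, 1 ≤ j → j ≤ n → c m (E j) = if m = j then 1 else 0)
    (k m : ℕ) (hk : 1 ≤ k) (hm : 1 ≤ m) (hkm : m + k ≤ n) (x : g) :
    c (m + k) ⁅E k, x⁆ = ((m : K) - k) * c m x := by
  have : (c (m + k)) ∘ₗ (LieAlgebra.ad K g (E k) : g →ₗ[K] g) = ((m : K) - k) • c m := by
    apply ext_E hV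
    intro j h1 h2
    simp only [LinearMap.comp_apply, LieAlgebra.ad_apply, LinearMap.smul_apply]
    rw [br hV k j hk h1, hc m j h1 h2, map_smul]
    by_cases hj : k + j ≤ n
    · rw [hc _ _ (by omega) hj]
      by_cases hmj : m = j
      · subst hmj; simp [add_comm]
      · rw [if_neg (by omega), if_neg hmj]; simp
    · rw [hV.2.1 _ (Or.inr (by omega)), if_neg (by omega)]; simp
  simpa using LinearMap.congr_fun this x

lemma core {n : ℕ} (hn : 12 ≤ n) {E : ℕ → g} (hV : IsVnBasis K n E) {c : ℕ → g →ₗ[K] K}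
    (hc : ∀ m j, 1 ≤ j → j ≤ n → c m (E j) = if m = j then 1 else 0)
    (hx : ∀ x, (x = ∑ m ∈ Finset.Icc 1 n, c m x • E m))
    (D : g →ₗ[K] g) (hD : ∀ x y : g, D ⁅x, y⁆ = ⁅D x, y⁆ + ⁅x, D y⁆)
    (a : K) (h1 : D (E 1) = a • E 2) (h2 : ∀ m, m ≤ 3 ∨ n - 2 ≤ m → m ≤ n → c m (D (E 2)) = 0) :
    D = 0 := by
  set y := D (E 2) with hy
  have b12 := br hV 1 2 (by omega) (by omega)
  have b13 := br hV 1 3 (by omega) (by omega)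
  have b14 := br hV 1 4 (by omega) (by omega)
  have b15 := br hV 1 5 (by omega) (by omega)
  have b23 := br hV 2 3 (by omega) (by omega)
  have b24 := br hV 2 4 (by omega) (by omega)
  norm_num at b12 b13 b14 b15 b23 b24
  have d3 : D (E 3) = ⁅E 1, y⁆ := by
    rw [← b12, hD, h1, ← hy]; simp
  have d4 : (2 : K) • D (E 4) = a • E 5 + ⁅E 1, ⁅E 1, y⁆⁆ := by
    rw [← map_smul, ← b13, hD, h1, d3, smul_lie, b23]
  have d5 : (3 : K) • D (E 5) = (2 * a) • E 6 + ⁅E 1, D (E 4)⁆ := by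
    rw [← map_smul, ← b14, hD, h1, smul_lie, b24, smul_smul, mul_comm]
  have d5' : (6 : K) • D (E 5) = (8 * a) • E 6 + ⁅E 1, ⁅E 1, ⁅E 1, y⁆⁆⁆ := by
    have : (6 : K) • D (E 5) = (2 : K) • ((3 : K) • D (E 5)) := by rw [smul_smul]; norm_num
    rw [this, d5, smul_add, ← lie_smul, d4, lie_add, lie_smul, b15, smul_smul, smul_smul,
      ← add_assoc, ← add_smul]
    congr 2; ring
  have e5 : D (E 5) = -⁅E 3, y⁆ + ⁅E 2, ⁅E 1, y⁆⁆ := by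
    rw [← b23, hD, d3, ← hy, lie_skew]
  have key : ∀ m, 1 ≤ m → m + 3 ≤ n →
      8 * a * (if m = 3 then 1 else 0) + ((m : K) - 3) * ((m : K) ^ 2 - 3 * m + 8) * c m y = 0 := by
    intro m hm hmn
    have A := congrArg (c (m + 3)) d5'
    rw [e5] at A
    simp only [map_add, map_smul, map_neg, smul_eq_mul] at A
    rw [hc _ _ (by omega) (by omega), coef_br hV hc 3 m (by omega) hm hmn,
      show m + 3 = (m + 1) + 2 by ring, coef_br hV hc 2 (m+1) (by omega) (by omega) (by omega),
      coef_br hV hc 1 m (by omega) (by omega) (by omega),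
      show m + 1 + 2 = (m + 1 + 1) + 1 by ring,
      coef_br hV hc 1 (m+1+1) (by omega) (by omega) (by omega),
      coef_br hV hc 1 (m+1) (by omega) (by omega) (by omega),
      coef_br hV hc 1 m (by omega) (by omega) (by omega)] at A
    have : (m + 1 + 1 + 1 = 6) ↔ m = 3 := by omega
    simp only [this] at A
    push_cast at A
    linear_combination -A
  have ha : a = 0 := by
    have := key 3 (by omega) (by omega)
    simpa using this
  have hy0 : y = 0 := by
    rw [hx y]
    apply Finset.sum_eq_zero
    intro m hm
    simp only [Finset.mem_Icc] at hm
    have : c m y = 0 := by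
      by_cases h : m ≤ 3 ∨ n - 2 ≤ m
      · exact h2 m h hm.2
      · push Not at h
        have k := key m hm.1 (by omega)
        obtain ⟨t, rfl⟩ : ∃ t, m = t + 4 := ⟨m - 4, by omega⟩
        rw [ha] at k
        push_cast at k
        have p1 : ((t : K) + 4 - 3) ≠ 0 := by
          have : ((t + 1 : ℕ) : K) ≠ 0 := by exact_mod_cast (by omega : t + 1 ≠ 0)
          intro h; apply this; push_cast; linear_combination h
        have p2 : (((t : K) + 4) ^ 2 - 3 * (t + 4) + 8) ≠ 0 := by
          have : ((t ^ 2 + 5 * t + 12 : ℕ) : K) ≠ 0 := by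
            exact_mod_cast (by omega : t ^ 2 + 5 * t + 12 ≠ 0)
          intro h; apply this; push_cast; linear_combination h
        have k' : ((t : K) + 4 - 3) * (((t : K) + 4) ^ 2 - 3 * (t + 4) + 8) * c (t + 4) y = 0 := by
          linear_combination k
        exact (mul_eq_zero.mp k').resolve_left (mul_ne_zero p1 p2)
    rw [this, zero_smul]
  have hd1 : D (E 1) = 0 := by rw [h1, ha, zero_smul]
  have all : ∀ j, D (E (j + 2)) = 0 := by
    intro j
    induction j with
    | zero => exact hy0
    | succ j ih =>
      have b := br hV 1 (j + 2) (by omega) (by omega)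
      have e := hD (E 1) (E (j + 2))
      rw [b, hd1, ih, map_smul] at e
      simp only [zero_lie, lie_zero, add_zero] at e
      have : ((j + 1 : ℕ) : K) ≠ 0 := by exact_mod_cast (by omega : j + 1 ≠ 0)
      rw [show 1 + (j + 2) = j + 1 + 2 by ring] at e
      refine (smul_eq_zero.mp e).resolve_left ?_
      intro h; apply this; push_cast at h ⊢; linear_combination h
  apply ext_E hV
  intro j hj _
  by_cases h : j = 1
  · subst h; simpa using hd1
  · have := all (j - 2)
    rw [show j - 2 + 2 = j by omega] at this
    simpa using this

lemma mem_span_E {n : ℕ} {E : ℕ → g} (hV : IsVnBasis K n E) (i m : ℕ) (h : i < m) :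
    E m ∈ Submodule.span K (E '' Set.Icc (i + 1) n) := by
  by_cases hm : n < m
  · rw [hV.2.1 m (Or.inr hm)]; exact zero_mem _
  · exact Submodule.subset_span ⟨m, ⟨by omega, by omega⟩, rfl⟩

lemma ad_mem {n : ℕ} {E : ℕ → g} (hV : IsVnBasis K n E) (k : ℕ) (hk : 1 ≤ k) :
    (LieAlgebra.ad K g (E k) : g →ₗ[K] g) ∈ triangularDerivations K n E := by
  refine ⟨fun x y => ?_, fun i hi _ => ?_⟩
  · simp
  · rw [LieAlgebra.ad_apply, br hV k i hk hi]
    exact Submodule.smul_mem _ _ (mem_span_E hV _ _ (by omega))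

lemma der_of {n : ℕ} {E : ℕ → g} (hV : IsVnBasis K n E) (D : g →ₗ[K] g)
    (h : ∀ i j, 1 ≤ i → i < j → j ≤ n → D ⁅E i, E j⁆ = ⁅D (E i), E j⁆ + ⁅E i, D (E j)⁆) :
    ∀ x y : g, D ⁅x, y⁆ = ⁅D x, y⁆ + ⁅x, D y⁆ := by
  have h' : ∀ i j, 1 ≤ i → i ≤ n → 1 ≤ j → j ≤ n →
      D ⁅E i, E j⁆ = ⁅D (E i), E j⁆ + ⁅E i, D (E j)⁆ := by
    intro i j hi hin hj hjn
    rcases lt_trichotomy i j with hij | hij | hij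
    · exact h i j hi hij hjn
    · subst hij
      rw [lie_self, map_zero, ← lie_skew (D (E i)) (E i), neg_add_cancel]
    · rw [← lie_skew, map_neg, h j i hj hij hin, ← lie_skew (E i) (D (E j)),
        ← lie_skew (D (E i)) (E j)]
      abel
  have h'' : ∀ i, 1 ≤ i → i ≤ n → ∀ y, D ⁅E i, y⁆ = ⁅D (E i), y⁆ + ⁅E i, D y⁆ := by
    intro i hi hin y
    have : D ∘ₗ (LieAlgebra.ad K g (E i) : g →ₗ[K] g) = (LieAlgebra.ad K g (D (E i)) : g →ₗ[K] g)
        + (LieAlgebra.ad K g (E i) : g →ₗ[K] g) ∘ₗ D := by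
      apply ext_E hV
      intro j hj hjn
      simpa using h' i j hi hin hj hjn
    simpa using LinearMap.congr_fun this y
  intro x y
  have : D ∘ₗ (-(LieAlgebra.ad K g y : g →ₗ[K] g)) = (-(LieAlgebra.ad K g y : g →ₗ[K] g)) ∘ₗ D
      - (LieAlgebra.ad K g (D y) : g →ₗ[K] g) := by
    apply ext_E hV
    intro j hj hjn
    have := h'' j hj hjn y
    simp only [LinearMap.comp_apply, LinearMap.neg_apply, LinearMap.sub_apply, LieAlgebra.ad_apply,
      lie_skew]
    rw [this, ← lie_skew (E j) (D y)]
    abel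
  have := LinearMap.congr_fun this x
  simp only [LinearMap.comp_apply, LinearMap.neg_apply, LinearMap.sub_apply, LieAlgebra.ad_apply,
      lie_skew] at this
  rw [this, ← lie_skew x (D y)]
  abel

lemma outer {n : ℕ} (hn : 12 ≤ n) {E : ℕ → g} (hV : IsVnBasis K n E) (p : ℕ) (hp : n - 2 ≤ p) :
    ∃ D ∈ triangularDerivations K n E, D (E 1) = 0 ∧ D (E 2) = E p := by
  obtain ⟨D, hD⟩ := exists_map hV (fun j =>
    if j = 2 then E p else if j = 3 then ((p : K) - 1) • E (p + 1)
    else if j = 4 then (((p : K) - 1) * p / 2) • E (p + 2) else 0)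
  have D1 := hD 1 (by omega) (by omega)
  have D2 := hD 2 (by omega) (by omega)
  have D3 := hD 3 (by omega) (by omega)
  have D4 := hD 4 (by omega) (by omega)
  norm_num at D1 D2 D3 D4
  have D5 : ∀ j, 5 ≤ j → D (E j) = 0 := by
    intro j hj
    by_cases h : j ≤ n
    · rw [hD j (by omega) h, if_neg (by omega), if_neg (by omega), if_neg (by omega)]
    · rw [hV.2.1 j (Or.inr (by omega)), map_zero]
  have Z : ∀ m, p + 3 ≤ m → E m = 0 := fun m hm => hV.2.1 m (Or.inr (by omega))
  have DE : ∀ j, 1 ≤ j → ∃ s : K, D (E j) = s • E (p + j - 2) := by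
    intro j hj
    by_cases h1 : j = 1
    · subst h1; exact ⟨0, by simp [D1]⟩
    by_cases h2 : j = 2
    · subst h2; exact ⟨1, by simp [D2]⟩
    by_cases h3 : j = 3
    · subst h3; exact ⟨_, D3⟩
    by_cases h4 : j = 4
    · subst h4; exact ⟨_, D4⟩
    exact ⟨0, by simp [D5 j (by omega)]⟩
  refine ⟨D, ⟨der_of hV D ?_, ?_⟩, D1, D2⟩
  · intro i j hi hij hjn
    by_cases h5 : 5 ≤ i + j
    · obtain ⟨s, hs⟩ := DE i hi
      obtain ⟨t, ht⟩ := DE j (by omega)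
      rw [hs, ht, smul_lie, lie_smul, br hV i j hi (by omega), br hV _ j (by omega) (by omega),
        br hV i _ hi (by omega), map_smul, D5 _ h5, Z _ (by omega), Z _ (by omega)]
      simp
    · obtain ⟨rfl, h⟩ : i = 1 ∧ (j = 2 ∨ j = 3) := by omega
      rcases h with rfl | rfl
      · rw [br hV 1 2 (by omega) (by omega), D1, D2, br hV 1 p (by omega) (by omega)]
        norm_num [D3, add_comm]
      · rw [br hV 1 3 (by omega) (by omega), D1, D3, lie_smul, br hV 1 (p+1) (by omega) (by omega)]
        norm_num [D4, smul_smul]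
        rw [show 1 + (p + 1) = p + 2 by ring]
        congr 1
        ring
  · intro i hi _
    by_cases h1 : i = 1
    · subst h1; rw [D1]; exact zero_mem _
    · obtain ⟨s, hs⟩ := DE i hi
      rw [hs]
      exact Submodule.smul_mem _ _ (mem_span_E hV _ _ (by omega))

end Aux

theorem statement6 {K : Type*} [Field K] [CharZero K]
    {g : Type*} [LieRing g] [LieAlgebra K g]
    (n : ℕ) (hn : 12 ≤ n) (E : ℕ → g) (hV : IsVnBasis K n E) :
    Module.finrank K (triangularDerivations K n E) = n + 2 := by
  obtain ⟨c, hc, hx⟩ := Aux.exists_coef hV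
  have c0 : ∀ D ∈ triangularDerivations K n E, ∀ i m, 1 ≤ i → i ≤ n → m ≤ i →
      c m (D (E i)) = 0 := by
    intro D hD i m hi hin hm
    have : Submodule.span K (E '' Set.Icc (i + 1) n) ≤ LinearMap.ker (c m) := by
      rw [Submodule.span_le]
      rintro _ ⟨j, ⟨hj1, hj2⟩, rfl⟩
      simp only [SetLike.mem_coe, LinearMap.mem_ker]
      rw [hc m j (by omega) hj2, if_neg (by omega)]
    exact this (hD.2 i hi hin)
  let q : Fin 4 → ℕ := ![3, n - 2, n - 1, n]
  let Φ : triangularDerivations K n E →ₗ[K] (Fin (n - 2) → K) × (Fin 4 → K) :=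
    LinearMap.prod
      (LinearMap.pi fun i => (c ((i : ℕ) + 3)) ∘ₗ (LinearMap.applyₗ (E 1)) ∘ₗ
        (triangularDerivations K n E).subtype)
      (LinearMap.pi fun i => (c (q i)) ∘ₗ (LinearMap.applyₗ (E 2)) ∘ₗ
        (triangularDerivations K n E).subtype)
  have Φ1 : ∀ D i, (Φ D).1 i = c ((i : ℕ) + 3) (D.1 (E 1)) := fun D i => rfl
  have Φ2 : ∀ D i, (Φ D).2 i = c (q i) (D.1 (E 2)) := fun D i => rfl
  have inj : Function.Injective Φ := by
    rw [injective_iff_map_eq_zero]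
    intro D hD
    have A1 : ∀ i : Fin (n - 2), c ((i : ℕ) + 3) (D.1 (E 1)) = 0 := fun i => by
      rw [← Φ1, hD]; rfl
    have A2 : ∀ i : Fin 4, c (q i) (D.1 (E 2)) = 0 := fun i => by
      rw [← Φ2, hD]; rfl
    apply Subtype.ext
    refine Aux.core hn hV hc hx D.1 D.2.1 (c 2 (D.1 (E 1))) ?_ ?_
    · conv_lhs => rw [hx (D.1 (E 1))]
      rw [Finset.sum_eq_single 2]
      · intro m hm hm2
        simp only [Finset.mem_Icc] at hm
        have : c m (D.1 (E 1)) = 0 := by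
          by_cases h : m ≤ 1
          · exact c0 D.1 D.2 1 m le_rfl (by omega) h
          · have := A1 ⟨m - 3, by omega⟩
            simpa [show m - 3 + 3 = m by omega] using this
        rw [this, zero_smul]
      · intro h; simp at h; omega
    · intro m hm hmn
      by_cases h : m ≤ 2
      · exact c0 D.1 D.2 2 m (by omega) (by omega) h
      · obtain h | h | h | h : m = 3 ∨ m = n - 2 ∨ m = n - 1 ∨ m = n := by omega
        · rw [h]; exact A2 0
        · rw [h]; exact A2 1
        · rw [h]; exact A2 2
        · rw [h]; exact A2 3
  have surj : Function.Surjective Φ := by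
    rintro ⟨u, v⟩
    obtain ⟨P, hP, hP1⟩ : ∃ P ∈ triangularDerivations K n E,
        ∀ i : Fin (n - 2), c ((i : ℕ) + 3) (P (E 1)) = u i := by
      refine ⟨∑ i : Fin (n - 2), (-(u i) / ((i : ℕ) + 1 : K)) •
        (LieAlgebra.ad K g (E ((i : ℕ) + 2)) : g →ₗ[K] g),
        Submodule.sum_mem _ fun i _ => Submodule.smul_mem _ _ (Aux.ad_mem hV _ (by omega)), ?_⟩
      intro i
      simp only [LinearMap.sum_apply, LinearMap.smul_apply, LieAlgebra.ad_apply, map_sum, map_smul]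
      rw [Finset.sum_eq_single i]
      · rw [Aux.br hV _ 1 (by omega) (by omega), map_smul, hc _ _ (by omega) (by omega), if_pos rfl]
        have : (((i : ℕ) : K) + 1) ≠ 0 := by exact_mod_cast (by omega : (i : ℕ) + 1 ≠ 0)
        simp only [smul_eq_mul]
        push_cast
        field_simp
        ring
      · intro j _ hj
        have : (i : ℕ) ≠ j := fun h => hj (Fin.ext h.symm)
        rw [Aux.br hV _ 1 (by omega) (by omega), map_smul, hc _ _ (by omega) (by omega),
          if_neg (by omega)]
        simp
      · simp
    have hO : ∀ i : Fin 4, ∃ D ∈ triangularDerivations K n E, D (E 1) = 0 ∧ D (E 2) = E (q i) := by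
      intro i
      fin_cases i
      · refine ⟨_, Aux.ad_mem hV 1 le_rfl, by simp, ?_⟩
        rw [LieAlgebra.ad_apply, Aux.br hV 1 2 (by omega) (by omega)]
        norm_num [q]
      · exact Aux.outer hn hV (n - 2) (by omega)
      · exact Aux.outer hn hV (n - 1) (by omega)
      · exact Aux.outer hn hV n (by omega)
    choose O hO hO1 hO2 using hO
    have hq : ∀ i j, c (q i) (E (q j)) = if i = j then 1 else 0 := by
      intro i j
      have qj : 1 ≤ q j ∧ q j ≤ n := by
        fin_cases j <;> simp [q] <;> omega
      rw [hc _ _ qj.1 qj.2]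
      have : q i = q j ↔ i = j := by
        fin_cases i <;> fin_cases j <;> simp [q] <;> omega
      simp only [this]
    refine ⟨⟨P + ∑ i, (v i - c (q i) (P (E 2))) • O i, add_mem hP
      (Submodule.sum_mem _ fun i _ => Submodule.smul_mem _ _ (hO i))⟩, ?_⟩
    apply Prod.ext
    · funext i
      rw [Φ1]
      simp [hO1, hP1]
    · funext i
      rw [Φ2]
      simp [hO2, hq]
  rw [(LinearEquiv.ofBijective Φ ⟨inj, surj⟩).finrank_eq]
  simp
  omega

end Paper
end
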